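/- Let k, n ∈ ℕ with 2^{k+1} ≤ n, write n = 2^{a_1} + ⋯ + 2^{a_r} with a_1 > ⋯ > a_r ≥ 0, let p, q be maximal with a_p ≥ k+1 and a_q ≥ k respectively, and set b_j = a_j − k. Let λ ∈ O(n; τ) with Q_2^{(k)}(λ) = (λ_1, …, λ_{2^k}) and τ = (n_1, …, n_{2^k}). Then λ ∈ 𝒢_k(n; τ) if and only if there is s ∈ {1, …, 2^k} such that both 2^{b_p} ⊆_2 n_s and 2^{b_q} ⊆_2 n_s and λ_s ∈ 𝒢_0(n_s). -/

import Mathlib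

namespace OddSym

open scoped Classical

/-- Remove one box from a row of size `p` (as multisets of parts). -/
def removeBox (lam : Multiset ℕ) (p : ℕ) : Multiset ℕ :=
  if p ≤ 1 then lam.erase p else (p - 1) ::ₘ lam.erase p

lemma removeBox_sum_lt {lam : Multiset ℕ} {p : ℕ} (hp : p ∈ lam) (h0 : 0 < p) :
    (removeBox lam p).sum < lam.sum := by
  have h : p + (lam.erase p).sum = lam.sum := by
    conv_rhs => rw [← Multiset.cons_erase hp]
    simp [Multiset.sum_cons]
  unfold removeBox
  split
  · omega
  · simp only [Multiset.sum_cons]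
    omega

/-- The number of standard Young tableaux of shape `lam`
(equivalently, the degree of the irreducible character of the symmetric
group labelled by `lam`), defined via the branching rule. -/
def degSYT (lam : Multiset ℕ) : ℕ :=
  if _h : lam = 0 then 1
  else ∑ p ∈ (lam.toFinset.filter (fun p => 0 < p)).attach, degSYT (removeBox lam p.1)
termination_by lam.sum
decreasing_by
  have hp := p.2
  simp only [Finset.mem_filter, Multiset.mem_toFinset] at hp
  exact removeBox_sum_lt hp.1 hp.2

/-- `lam` is an odd partition: all parts positive and the number of standard
Young tableaux of shape `lam` (= the character degree) is odd. -/
def OddP (lam : Multiset ℕ) : Prop :=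
  (∀ x ∈ lam, 0 < x) ∧ Odd (degSYT lam)

/-- The parts of `lam` sorted in weakly decreasing order. -/
def descList (lam : Multiset ℕ) : List ℕ :=
  (lam.sort (· ≤ ·)).reverse

/-- The beta-set (set of beta-numbers) of `lam` with `m` beads:
`{ lam_i + (m - i) : 1 ≤ i ≤ m }` where `lam` is padded with zero parts. -/
def betaSet (lam : Multiset ℕ) (m : ℕ) : Finset ℕ :=
  (Finset.range m).image (fun i => (descList lam).getD i 0 + (m - 1 - i))

/-- `mu` is obtained from `lam` by removing an `e`-hook: in some beta-set of
`lam` a beta-number `x` is replaced by `x - e` (which is not a beta-number). -/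
def IsHookRemoval (e : ℕ) (lam mu : Multiset ℕ) : Prop :=
  (∀ x ∈ lam, 0 < x) ∧ (∀ x ∈ mu, 0 < x) ∧ 0 < e ∧
  ∃ m x, Multiset.card lam ≤ m ∧ Multiset.card mu ≤ m ∧
    x ∈ betaSet lam m ∧ e ≤ x ∧ x - e ∉ betaSet lam m ∧
    betaSet mu m = insert (x - e) ((betaSet lam m).erase x)

/-- The map `f_k` : for an odd partition `lam` with `2^k ≤ |lam|`, the unique
odd partition obtained from `lam` by removing a `2^k`-hook (junk value `0` if
no such partition exists). -/
noncomputable def fkOp (k : ℕ) (lam : Multiset ℕ) : Multiset ℕ :=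
  if h : ∃ mu, IsHookRemoval (2 ^ k) lam mu ∧ OddP mu then h.choose else 0

/-- The partition encoded by a finite beta-set: each bead contributes a part
equal to the number of gaps below it. -/
def partOfBeta (S : Finset ℕ) : Multiset ℕ :=
  (S.val.map (fun b => b - (S.filter (fun a => a < b)).card)).filter (fun p => 0 < p)

/-- The 2-quotient `(lam_0, lam_1)` of `lam`, computed from a beta-set with an
even number of beads via the two runners of the 2-abacus. -/
def quot2 (lam : Multiset ℕ) : Multiset ℕ × Multiset ℕ :=
  (partOfBeta (((betaSet lam (2 * Multiset.card lam)).filter (fun b => b % 2 = 0)).image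
      (fun b => b / 2)),
   partOfBeta (((betaSet lam (2 * Multiset.card lam)).filter (fun b => b % 2 = 1)).image
      (fun b => b / 2)))

/-- The `e`-core of `lam`: push all beads of an `e`-abacus configuration for
`lam` up as far as possible. -/
def coreP (e : ℕ) (lam : Multiset ℕ) : Multiset ℕ :=
  partOfBeta ((Finset.range (e * (Multiset.card lam + e))).filter
    (fun x => x / e <
      ((betaSet lam (Multiset.card lam + e)).filter (fun b => b % e = x % e)).card))

/-- Row `k` of the 2-quotient tower of `lam`: row 0 is `[lam]`, and row `k+1`
replaces each entry of row `k` by its 2-quotient pair. -/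
def towerRow : ℕ → Multiset ℕ → List (Multiset ℕ)
  | 0, lam => [lam]
  | (k + 1), lam => (towerRow k lam).flatMap (fun mu => [(quot2 mu).1, (quot2 mu).2])

/-- `R_k^j(lam)`: the component of row `k` of the 2-quotient tower of `lam`
from which a `2^(j-k)`-hook is removed in the passage from `lam` to `f_j(lam)`;
it is characterized by: row `k` for `f_j(lam)` is obtained from row `k` for
`lam` by replacing this component by its image under `f_(j-k)`. -/
noncomputable def Rcomp (k j : ℕ) (lam : Multiset ℕ) : Multiset ℕ :=
  if h : ∃ s, s < 2 ^ k ∧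
      towerRow k (fkOp j lam) =
        (towerRow k lam).set s (fkOp (j - k) ((towerRow k lam).getD s 0))
  then (towerRow k lam).getD h.choose 0 else 0

/-- The number of unoccupied positions below `b`. -/
def gaps (X : Finset ℕ) (b : ℕ) : ℕ := b - (X.filter (fun a => a < b)).card

/-- The size of the partition encoded by a beta-set. -/
def size (X : Finset ℕ) : ℕ := (partOfBeta X).sum

/-- The beads which can be moved down by `e` positions. -/
def movable (e : ℕ) (X : Finset ℕ) : Finset ℕ := X.filter (fun s => e ≤ s ∧ s - e ∉ X)

/-- Move the bead at `s` down by `e` positions. -/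
def slide (e s : ℕ) (X : Finset ℕ) : Finset ℕ := insert (s - e) (X.erase s)

lemma mem_movable {e s : ℕ} {X : Finset ℕ} :
    s ∈ movable e X ↔ s ∈ X ∧ e ≤ s ∧ s - e ∉ X := by
  simp [movable]

lemma mem_slide {e s x : ℕ} {X : Finset ℕ} :
    x ∈ slide e s X ↔ x = s - e ∨ (x ≠ s ∧ x ∈ X) := by
  simp [slide]

lemma card_slide {e s : ℕ} {X : Finset ℕ} (h : s ∈ movable e X) :
    (slide e s X).card = X.card := by
  rw [mem_movable] at h
  rw [slide, Finset.card_insert_of_notMem (by simp [h.2.2]), Finset.card_erase_add_one h.1]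

lemma card_filter_lt_le (X : Finset ℕ) (b : ℕ) : (X.filter (fun a => a < b)).card ≤ b := by
  calc _ ≤ (Finset.range b).card := Finset.card_le_card (fun x => by simp)
    _ = b := by simp

lemma gaps_add (X : Finset ℕ) (b : ℕ) :
    gaps X b + (X.filter (fun a => a < b)).card = b :=
  Nat.sub_add_cancel (card_filter_lt_le X b)

lemma card_filter_lt_succ (X : Finset ℕ) (b : ℕ) :
    (X.filter (fun a => a < b + 1)).card =
      (X.filter (fun a => a < b)).card + if b ∈ X then 1 else 0 := by
  have h : X.filter (fun a => a < b + 1) = X.filter (fun a => a < b) ∪ X.filter (fun a => a = b) := by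
    ext x
    simp only [Finset.mem_filter, Finset.mem_union]
    grind
  rw [h, Finset.card_union_of_disjoint]
  · congr 1
    rw [Finset.filter_eq']
    split <;> simp
  · rw [Finset.disjoint_filter]
    intro x _ h1 h2
    omega

lemma gaps_succ (X : Finset ℕ) (b : ℕ) :
    gaps X (b + 1) = gaps X b + if b ∈ X then 0 else 1 := by
  have h1 := gaps_add X b
  have h2 := gaps_add X (b + 1)
  rw [card_filter_lt_succ] at h2
  split_ifs at * <;> omega

lemma gaps_mono (X : Finset ℕ) : Monotone (gaps X) :=
  monotone_nat_of_le_succ (fun b => by rw [gaps_succ]; omega)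

lemma sum_filter_pos (M : Multiset ℕ) : (M.filter (fun p => 0 < p)).sum = M.sum := by
  induction M using Multiset.induction with
  | empty => simp
  | cons a s ih =>
    by_cases h : 0 < a
    · rw [Multiset.filter_cons_of_pos _ h]; simp [ih]
    · rw [Multiset.filter_cons_of_neg _ h, ih]; simp; omega

lemma partOfBeta_eq (X : Finset ℕ) :
    partOfBeta X = (X.val.map (gaps X)).filter (fun p => 0 < p) := rfl

lemma pos_of_mem_partOfBeta {X : Finset ℕ} : ∀ x ∈ partOfBeta X, 0 < x := by
  intro x hx
  exact (Multiset.mem_filter.1 hx).2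

lemma size_eq (X : Finset ℕ) : size X = ∑ b ∈ X, gaps X b := by
  rw [size, partOfBeta_eq, sum_filter_pos]; rfl

lemma map_gaps_insert {X : Finset ℕ} {M : ℕ} (h : ∀ x ∈ X, x < M) :
    (insert M X).val.map (gaps (insert M X)) = (M - X.card) ::ₘ X.val.map (gaps X) := by
  have hM : M ∉ X := fun hM => lt_irrefl _ (h M hM)
  rw [Finset.insert_val_of_notMem hM, Multiset.map_cons]
  congr 1
  · unfold gaps
    congr 2
    ext x
    simp only [Finset.mem_filter, Finset.mem_insert]
    grind
  · refine Multiset.map_congr rfl (fun x hx => ?_)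
    unfold gaps
    congr 2
    ext y
    simp only [Finset.mem_filter, Finset.mem_insert]
    have := h x hx
    grind

lemma card_le_of_lt {X : Finset ℕ} {M : ℕ} (h : ∀ x ∈ X, x < M) : X.card ≤ M := by
  simpa using Finset.card_le_card (fun x hx => Finset.mem_range.2 (h x hx))

lemma size_add_choose (X : Finset ℕ) : size X + X.card.choose 2 = ∑ b ∈ X, b := by
  induction X using Finset.induction_on_max with
  | empty => simp [size_eq]
  | insert M X h ih =>
    have hM : M ∉ X := fun hM => lt_irrefl _ (h M hM)
    have h1 : size (insert M X) = (M - X.card) + size X := by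
      rw [size, size, partOfBeta_eq, partOfBeta_eq, sum_filter_pos, sum_filter_pos,
        map_gaps_insert h]
      simp
    have := card_le_of_lt h
    rw [h1, Finset.sum_insert hM, Finset.card_insert_of_notMem hM, Nat.choose_succ_left _ _ (by omega)]
    simp
    omega

lemma sum_slide {e s : ℕ} {X : Finset ℕ} (h : s ∈ movable e X) :
    ∑ b ∈ slide e s X, b + e = ∑ b ∈ X, b := by
  rw [mem_movable] at h
  rw [slide, Finset.sum_insert (by simp [h.2.2]), ← Finset.add_sum_erase X _ h.1]
  omega

lemma size_slide {e s : ℕ} {X : Finset ℕ} (h : s ∈ movable e X) :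
    size (slide e s X) + e = size X := by
  have h1 := size_add_choose (slide e s X)
  have h2 := size_add_choose X
  have h3 := sum_slide h
  rw [card_slide h] at h1
  omega

lemma map_gaps_injective {X Y : Finset ℕ}
    (h : X.val.map (gaps X) = Y.val.map (gaps Y)) : X = Y := by
  induction X using Finset.induction_on_max generalizing Y with
  | empty =>
    have := congrArg Multiset.card h
    simp at this
    exact (Finset.card_eq_zero.1 this.symm).symm
  | insert M X hX ih =>
    have hM : M ∉ X := fun hM => lt_irrefl _ (hX M hM)
    have hc := congrArg Multiset.card h
    rw [map_gaps_insert hX] at hc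
    simp only [Multiset.card_cons, Multiset.card_map, Finset.card_val] at hc
    have hne : Y.Nonempty := Finset.card_pos.1 (by omega)
    obtain ⟨M', Z, hZ, rfl⟩ : ∃ M' Z, (∀ x ∈ Z, x < M') ∧ Y = insert M' Z :=
      ⟨Y.max' hne, Y.erase (Y.max' hne), fun x hx => Finset.lt_max'_of_mem_erase_max' Y hne hx,
        (Finset.insert_erase (Finset.max'_mem Y hne)).symm⟩
    have hM' : M' ∉ Z := fun hM => lt_irrefl _ (hZ _ hM)
    rw [Finset.card_insert_of_notMem hM'] at hc
    have hle : ∀ {N : ℕ} {W : Finset ℕ}, (∀ x ∈ W, x < N) →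
        ∀ g ∈ (insert N W).val.map (gaps (insert N W)), g ≤ N - W.card := by
      intro N W hW g hg
      obtain ⟨x, hx, rfl⟩ := Multiset.mem_map.1 hg
      have hN : N ∉ W := fun hN => lt_irrefl _ (hW _ hN)
      have hx' : x ≤ N := by
        rcases Finset.mem_insert.1 hx with rfl | hx
        · exact le_rfl
        · exact (hW x hx).le
      refine (gaps_mono _ hx').trans (le_of_eq ?_)
      unfold gaps
      congr 2
      ext y
      simp only [Finset.mem_filter, Finset.mem_insert]
      grind
    have h1 := hle hZ (M - X.card) (by rw [← h, map_gaps_insert hX]; simp)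
    have h2 := hle hX (M' - Z.card) (by rw [h, map_gaps_insert hZ]; simp)
    have h3 := card_le_of_lt hX
    have h4 := card_le_of_lt hZ
    have h5 : M = M' := by omega
    subst h5
    rw [map_gaps_insert hX, map_gaps_insert hZ] at h
    have h6 : X.card = Z.card := by omega
    rw [h6, Multiset.cons_inj_right] at h
    rw [ih h]

lemma filter_pos_injective {M N : Multiset ℕ} (hc : Multiset.card M = Multiset.card N)
    (h : M.filter (fun p => 0 < p) = N.filter (fun p => 0 < p)) : M = N := by
  have key : ∀ M : Multiset ℕ, M = M.filter (fun p => 0 < p) +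
      Multiset.replicate (Multiset.card M - Multiset.card (M.filter (fun p => 0 < p))) 0 := by
    intro M
    induction M using Multiset.induction with
    | empty => simp
    | cons a s ih =>
      by_cases h : 0 < a
      · rw [Multiset.filter_cons_of_pos _ h]
        simpa using ih
      · have h0 : a = 0 := by omega
        subst h0
        have := Multiset.card_le_card (Multiset.filter_le (fun p => 0 < p) s)
        rw [Multiset.filter_cons_of_neg _ h, Multiset.card_cons, Nat.succ_sub this,
          Multiset.replicate_succ, Multiset.add_cons, ← ih]
  rw [key M, key N, h, hc]

lemma partOfBeta_injective {X Y : Finset ℕ} (hc : X.card = Y.card)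
    (h : partOfBeta X = partOfBeta Y) : X = Y :=
  map_gaps_injective (filter_pos_injective (by simpa using hc) h)

lemma card_partOfBeta_le (X : Finset ℕ) : Multiset.card (partOfBeta X) ≤ X.card := by
  simpa [partOfBeta_eq] using
    Multiset.card_le_card (Multiset.filter_le (fun p => 0 < p) (X.val.map (gaps X)))

lemma card_filter_lt_slide {e s : ℕ} {X : Finset ℕ} (h : s ∈ movable e X) (a : ℕ) :
    ((slide e s X).filter (fun x => x < a)).card + (if s < a then 1 else 0) =
      (X.filter (fun x => x < a)).card + if s - e < a then 1 else 0 := by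
  rw [mem_movable] at h
  simp only [Finset.card_filter]
  rw [slide, Finset.sum_insert (by simp [h.2.2]), ← Finset.add_sum_erase X _ h.1]
  omega

lemma gaps_slide_one {s a : ℕ} {X : Finset ℕ} (h : s ∈ movable 1 X) (ha : a ≠ s) :
    gaps (slide 1 s X) a = gaps X a := by
  have h1 := card_filter_lt_slide h a
  have h2 := mem_movable.1 h
  unfold gaps
  split_ifs at h1 <;> omega

lemma gaps_of_mem_movable_one {s : ℕ} {X : Finset ℕ} (h : s ∈ movable 1 X) :
    gaps X s = gaps X (s - 1) + 1 := by
  rw [mem_movable] at h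
  obtain ⟨t, rfl⟩ : ∃ t, s = t + 1 := ⟨s - 1, by omega⟩
  rw [gaps_succ]
  have : t ∉ X := by simpa using h.2.2
  simp [this]

lemma partOfBeta_slide_one {s : ℕ} {X : Finset ℕ} (h : s ∈ movable 1 X) :
    partOfBeta (slide 1 s X) = removeBox (partOfBeta X) (gaps X s) := by
  have hg := gaps_of_mem_movable_one h
  have h' := mem_movable.1 h
  have h1 : partOfBeta X = gaps X s ::ₘ
      ((X.erase s).val.map (gaps X)).filter (fun p => 0 < p) := by
    rw [partOfBeta_eq, ← Multiset.filter_cons_of_pos (p := fun p => 0 < p) _ (by omega), ← Multiset.map_cons]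
    congr 2
    rw [← Finset.insert_val_of_notMem (Finset.notMem_erase s X), Finset.insert_erase h'.1]
  have h2 : (slide 1 s X).val.map (gaps (slide 1 s X)) =
      (gaps X s - 1) ::ₘ (X.erase s).val.map (gaps X) := by
    have h3 : s - 1 ∉ X.erase s := by simp [h'.2.2]
    have h4 : (slide 1 s X).val = (s - 1) ::ₘ (X.erase s).val := by
      rw [slide, Finset.insert_val_of_notMem h3]
    rw [h4, Multiset.map_cons]
    congr 1
    · rw [gaps_slide_one h (by omega), hg]; simp
    · refine Multiset.map_congr rfl (fun x hx => gaps_slide_one h ?_)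
      exact Finset.ne_of_mem_erase hx
  rw [partOfBeta_eq (slide 1 s X), h2, removeBox, h1, Multiset.erase_cons_head]
  split_ifs with h5
  · rw [Multiset.filter_cons_of_neg _ (by omega)]
  · rw [Multiset.filter_cons_of_pos _ (by omega)]

lemma gaps_lt_of_movable_one {s t : ℕ} {X : Finset ℕ} (hst : s < t) (ht : t ∈ movable 1 X) :
    gaps X s < gaps X t := by
  have := gaps_mono X (show s ≤ t - 1 by omega)
  rw [gaps_of_mem_movable_one ht]
  omega

lemma exists_movable_one {X : Finset ℕ} {b : ℕ} (hb : b ∈ X) (h0 : 0 < gaps X b) :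
    ∃ s ∈ movable 1 X, gaps X s = gaps X b := by
  induction b with
  | zero => simp [gaps] at h0
  | succ b ih =>
    by_cases h : b ∈ X
    · have h1 := gaps_succ X b
      simp only [h, if_true, add_zero] at h1
      rw [h1]
      exact ih h (h1 ▸ h0)
    · exact ⟨b + 1, by simp [mem_movable, hb, h], rfl⟩

lemma degSYT_zero : degSYT 0 = 1 := by
  rw [degSYT]; simp

lemma degSYT_of_ne_zero {lam : Multiset ℕ} (h : lam ≠ 0) :
    degSYT lam = ∑ p ∈ lam.toFinset.filter (fun p => 0 < p), degSYT (removeBox lam p) := by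
  rw [degSYT, dif_neg h]
  exact Finset.sum_attach _ (fun p => degSYT (removeBox lam p))

lemma degSYT_partOfBeta {X : Finset ℕ} (h : partOfBeta X ≠ 0) :
    degSYT (partOfBeta X) = ∑ s ∈ movable 1 X, degSYT (partOfBeta (slide 1 s X)) := by
  rw [degSYT_of_ne_zero h]
  symm
  refine Finset.sum_bij (fun s _ => gaps X s) ?_ ?_ ?_ ?_
  · intro s hs
    have := gaps_of_mem_movable_one hs
    simp only [Finset.mem_filter, Multiset.mem_toFinset, partOfBeta_eq, Multiset.mem_filter,
      Multiset.mem_map]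
    exact ⟨⟨⟨s, (mem_movable.1 hs).1, rfl⟩, by omega⟩, by omega⟩
  · intro s hs t ht hst
    rcases lt_trichotomy s t with h1 | h1 | h1
    · exact absurd hst (gaps_lt_of_movable_one h1 ht).ne
    · exact h1
    · exact absurd hst (gaps_lt_of_movable_one h1 hs).ne'
  · intro p hp
    simp only [Finset.mem_filter, Multiset.mem_toFinset, partOfBeta_eq, Multiset.mem_filter,
      Multiset.mem_map] at hp
    obtain ⟨⟨⟨b, hb, rfl⟩, h0⟩, -⟩ := hp
    obtain ⟨s, hs, hg⟩ := exists_movable_one hb h0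
    exact ⟨s, hs, hg⟩
  · intro s hs
    rw [partOfBeta_slide_one hs]

lemma size_eq_zero_iff {X : Finset ℕ} : size X = 0 ↔ partOfBeta X = 0 := by
  constructor
  · intro h
    refine Multiset.eq_zero_of_forall_notMem (fun x hx => ?_)
    have h1 := pos_of_mem_partOfBeta x hx
    have h2 := Multiset.le_sum_of_mem hx
    rw [size] at h
    omega
  · intro h; simp [size, h]

/-- The degree modulo two of the partition encoded by a beta-set. -/
def deg (X : Finset ℕ) : ZMod 2 := (degSYT (partOfBeta X) : ℕ)

lemma deg_of_size_zero {X : Finset ℕ} (h : size X = 0) : deg X = 1 := by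
  rw [deg, size_eq_zero_iff.1 h, degSYT_zero, Nat.cast_one]

/-- The operator summing over all ways to move a bead down by `e` positions. -/
def lower (e : ℕ) (g : Finset ℕ → ZMod 2) (X : Finset ℕ) : ZMod 2 :=
  ∑ s ∈ movable e X, g (slide e s X)

lemma lower_one_deg {X : Finset ℕ} (h : 0 < size X) : lower 1 deg X = deg X := by
  have h1 : partOfBeta X ≠ 0 := fun h0 => by
    rw [size_eq_zero_iff.2 h0] at h; exact lt_irrefl _ h
  rw [deg, degSYT_partOfBeta h1, lower, Nat.cast_sum]
  rfl

lemma sum_sum_ne_eq_zero (A : Finset ℕ) (F : ℕ → ℕ → ZMod 2) (hF : ∀ s t, F s t = F t s) :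
    ∑ s ∈ A, ∑ t ∈ A.erase s, F s t = 0 := by
  induction A using Finset.induction_on with
  | empty => simp
  | insert a A ha ih =>
    rw [Finset.sum_insert ha, Finset.erase_insert ha]
    have h1 : ∀ s ∈ A, ∑ t ∈ (insert a A).erase s, F s t = F a s + ∑ t ∈ A.erase s, F s t := by
      intro s hs
      have hne : a ≠ s := fun h => ha (h ▸ hs)
      rw [Finset.erase_insert_of_ne hne, Finset.sum_insert (by simp [ha]), hF]
    rw [Finset.sum_congr rfl h1, Finset.sum_add_distrib, ih, add_zero]
    exact CharTwo.add_self_eq_zero _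

lemma slide_comm {e s t : ℕ} {X : Finset ℕ} (hs : s ∈ movable e X) (ht : t ∈ movable e X) :
    slide e t (slide e s X) = slide e s (slide e t X) := by
  rw [mem_movable] at hs ht
  ext x
  simp only [mem_slide]
  grind

lemma movable_slide {e s : ℕ} (he : 0 < e) {X : Finset ℕ} (hs : s ∈ movable e X) :
    movable e (slide e s X) = (movable e X).erase s ∪
      ((if 2 * e ≤ s ∧ s - 2 * e ∉ X then {s - e} else ∅) ∪ if s + e ∈ X then {s + e} else ∅) := by
  rw [mem_movable] at hs
  obtain ⟨h1, h2, h3⟩ := hs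
  ext t
  simp only [Finset.mem_union, mem_movable, mem_slide, Finset.mem_erase]
  have h4 : s - 2 * e = s - e - e := by omega
  rw [h4]
  have h5 : ∀ {p : Prop} [Decidable p] {a : ℕ}, (t ∈ if p then ({a} : Finset ℕ) else ∅) ↔ p ∧ t = a := by
    intro p _ a; split_ifs with h <;> simp [h]
  rw [h5, h5]
  by_cases ha : t = s - e
  · subst ha
    have : s - e ≠ s := by omega
    have : s - e - e ≠ s := by omega
    have : s - e ≠ s + e := by omega
    have : s - e - e ≠ s - e ∨ ¬ e ≤ s - e := by omega
    have : e ≤ s - e ↔ 2 * e ≤ s := by omega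
    grind
  by_cases hb : t = s + e
  · subst hb
    have : s + e - e = s := by omega
    have : s ≠ s - e := by omega
    have : s + e ≠ s := by omega
    grind
  · have : t - e = s → ¬ e ≤ t := by omega
    have : t - e = s - e → e ≤ t → t = s := by omega
    grind

lemma lower_lower {e : ℕ} (he : 0 < e) (g : Finset ℕ → ZMod 2) (X : Finset ℕ) :
    lower e (lower e g) X = lower (2 * e) g X := by
  have key : ∀ s ∈ movable e X, lower e g (slide e s X) =
      ∑ t ∈ (movable e X).erase s, g (slide e t (slide e s X)) +
      ((if 2 * e ≤ s ∧ s - 2 * e ∉ X then g (slide (2 * e) s X) else 0) +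
        if s + e ∈ X then g (slide (2 * e) (s + e) X) else 0) := by
    intro s hs
    have hs' := mem_movable.1 hs
    rw [lower, movable_slide he hs, Finset.sum_union, Finset.sum_union]
    · congr 2
      · split_ifs with h
        · rw [Finset.sum_singleton]
          congr 1
          ext x
          simp only [mem_slide]
          grind
        · simp
      · split_ifs with h
        · rw [Finset.sum_singleton]
          congr 1
          ext x
          simp only [mem_slide]
          grind
        · simp
    · split_ifs <;> simp; omega
    · rw [Finset.disjoint_left]
      intro t ht
      simp only [Finset.mem_erase, mem_movable] at ht
      split_ifs <;> simp <;> grind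
  rw [lower, Finset.sum_congr rfl key, Finset.sum_add_distrib]
  have h0 : ∑ s ∈ movable e X, ∑ t ∈ (movable e X).erase s, g (slide e t (slide e s X)) = 0 := by
    rw [← sum_sum_ne_eq_zero (movable e X) (fun s t =>
      if s ∈ movable e X ∧ t ∈ movable e X then g (slide e t (slide e s X)) else 0)]
    · refine Finset.sum_congr rfl (fun s hs => Finset.sum_congr rfl (fun t ht => ?_))
      rw [if_pos ⟨hs, Finset.mem_of_mem_erase ht⟩]
    · intro s t
      by_cases h : s ∈ movable e X ∧ t ∈ movable e X
      · rw [if_pos h, if_pos h.symm, slide_comm h.1 h.2]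
      · rw [if_neg h, if_neg (fun h' => h h'.symm)]
  rw [h0, zero_add, Finset.sum_add_distrib, ← Finset.sum_filter, ← Finset.sum_filter]
  have h1 : ∑ s ∈ (movable e X).filter (fun s => s + e ∈ X), g (slide (2 * e) (s + e) X) =
      ∑ s ∈ (movable (2 * e) X).filter (fun s => s - e ∈ X), g (slide (2 * e) s X) := by
    refine Finset.sum_bij' (fun s _ => s + e) (fun s _ => s - e) ?_ ?_ ?_ ?_ ?_
    · intro s hs
      simp only [Finset.mem_filter, mem_movable] at hs ⊢
      have : s + e - 2 * e = s - e := by omega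
      have : s + e - e = s := by omega
      grind
    · intro s hs
      simp only [Finset.mem_filter, mem_movable] at hs ⊢
      have : s - e - e = s - 2 * e := by omega
      have : s - e + e = s := by omega
      grind
    · intro s hs; simp
    · intro s hs
      simp only [Finset.mem_filter, mem_movable] at hs
      omega
    · intro s hs; rfl
  have h2 : (movable e X).filter (fun s => 2 * e ≤ s ∧ s - 2 * e ∉ X) =
      (movable (2 * e) X).filter (fun s => ¬ s - e ∈ X) := by
    ext s
    simp only [Finset.mem_filter, mem_movable]
    constructor
    · rintro ⟨⟨a, b, c⟩, d, f⟩; exact ⟨⟨a, d, f⟩, c⟩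
    · rintro ⟨⟨a, d, f⟩, c⟩; exact ⟨⟨a, by omega, c⟩, d, f⟩
  rw [h1, h2, add_comm, Finset.sum_filter_add_sum_filter_not]
  rfl

lemma lower_two_pow_deg (k : ℕ) {X : Finset ℕ} (h : 2 ^ k ≤ size X) :
    lower (2 ^ k) deg X = deg X := by
  induction k generalizing X with
  | zero => exact lower_one_deg (by rw [pow_zero] at h; exact h)
  | succ k ih =>
    rw [pow_succ] at h
    rw [pow_succ, mul_comm, ← lower_lower (by positivity), ← ih (X := X) (by omega)]
    refine Finset.sum_congr rfl (fun s hs => ih ?_)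
    have := size_slide hs
    omega

lemma exists_deg_eq_one {k : ℕ} {X : Finset ℕ} (h : 2 ^ k ≤ size X) (hd : deg X = 1) :
    ∃ s ∈ movable (2 ^ k) X, deg (slide (2 ^ k) s X) = 1 := by
  rw [← lower_two_pow_deg k h, lower] at hd
  obtain ⟨s, hs, hne⟩ := Finset.exists_ne_zero_of_sum_ne_zero (hd ▸ one_ne_zero)
  exact ⟨s, hs, Fin.eq_one_of_ne_zero _ hne⟩

lemma le_size_of_movable {e s : ℕ} {X : Finset ℕ} (hs : s ∈ movable e X) : e ≤ size X := by
  have := size_slide hs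
  omega

lemma mem_movable_slide {e s t : ℕ} {X : Finset ℕ} (hs : s ∈ movable e X)
    (ht : t ∈ movable e X) (hst : s ≠ t) : t ∈ movable e (slide e s X) := by
  simp only [mem_movable, mem_slide] at *
  grind

lemma movable_unique {e s t : ℕ} {X : Finset ℕ} (h : size X < 2 * e)
    (hs : s ∈ movable e X) (ht : t ∈ movable e X) : s = t := by
  by_contra hst
  have h1 := size_slide hs
  have h2 := size_slide (mem_movable_slide hs ht hst)
  omega

lemma not_movable_slide {e s t : ℕ} {X : Finset ℕ} (h : size X < 2 * e)
    (hs : s ∈ movable e X) : t ∉ movable e (slide e s X) := by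
  intro ht
  have h1 := size_slide hs
  have h2 := size_slide ht
  omega

lemma slide_exchange {e f x y z : ℕ} {X : Finset ℕ} (h : size X < 2 * e) (hf : 0 < f) (hfe : f < e)
    (hx : x ∈ movable f X) (hz : z ∈ movable e X) (hy : y ∈ movable e (slide f x X)) :
    ∃ w ∈ movable f (slide e z X),
      slide f w (slide e z X) = slide e y (slide f x X) ∧
      x = if w = z - e then z else if w = z + f then w - e else w := by
  have hsz := size_slide hx
  have no_later : ∀ t, t ∉ movable e (slide e z X) := fun t => not_movable_slide h hz
  have only : ∀ t ∈ movable e (slide f x X), t = y := fun t ht =>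
    movable_unique (by omega) ht hy
  have hx' := mem_movable.1 hx
  have hz' := mem_movable.1 hz
  have hy' := mem_movable.1 hy
  obtain ⟨x1, x2, x3⟩ := hx'
  obtain ⟨z1, z2, z3⟩ := hz'
  obtain ⟨y1, y2, y3⟩ := hy'
  by_cases hA : y = x - f
  · by_cases hxe : x - e ∈ X
    · exfalso
      have hzx : z ≠ x := fun hh => z3 (hh ▸ hxe)
      by_cases hze : z - e = x - f
      · refine no_later (x - f) ?_
        simp only [mem_movable, mem_slide] at *
        grind
      · have : z ∈ movable e (slide f x X) := by
          simp only [mem_movable, mem_slide] at *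
          grind
        have := only z this
        grind
    · have hzx : z = x := by
        refine movable_unique h hz ?_
        simp only [mem_movable]
        exact ⟨x1, by omega, hxe⟩
      subst hzx
      refine ⟨z - e, ?_, ?_, by simp⟩
      · have h1 : z - e - f = y - e := by omega
        have h2 : z - e ≠ y - e := by omega
        have h3 : f ≤ z - e := by omega
        clear no_later only
        simp only [mem_movable, mem_slide] at *
        grind
      · have h1 : z - e - f = y - e := by omega
        have h2 : z - f ≠ z := by omega
        clear no_later only
        ext u
        simp only [mem_movable, mem_slide] at *
        grind
  · by_cases hB : y - e = x
    · by_cases hxe : x + e - f ∈ X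
      · have hzx : z = x + e - f := by
          refine movable_unique h hz ?_
          have h1 : x + e - f - e = x - f := by omega
          simp only [mem_movable]
          exact ⟨hxe, by omega, h1 ▸ x3⟩
        have h1 : z - e = x - f := by omega
        have h2 : z + f = x + e := by omega
        have h3 : y = x + e := by omega
        have h4 : y - f = z := by omega
        refine ⟨y, ?_, ?_, ?_⟩
        · simp only [mem_movable, mem_slide] at *
          grind
        · ext u
          simp only [mem_movable, mem_slide] at *
          grind
        · rw [if_neg (by omega), if_pos (by omega), hB]
      · exfalso
        by_cases hzx : z = x
        · refine no_later y ?_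
          simp only [mem_movable, mem_slide] at *
          grind
        · have : z ∈ movable e (slide f x X) := by
            have : z - e ≠ x - f := fun hh => hxe (by
              have : x + e - f = z := by omega
              rwa [this])
            simp only [mem_movable, mem_slide] at *
            grind
          have := only z this
          simp only [mem_movable, mem_slide] at *
          grind
    · have hyz : y = z := by
        refine movable_unique h ?_ hz
        simp only [mem_movable, mem_slide] at *
        grind
      subst hyz
      refine ⟨x, ?_, ?_, ?_⟩
      · simp only [mem_movable, mem_slide] at *
        grind
      · ext u
        simp only [mem_movable, mem_slide] at *
        grind
      · have h1 : x ≠ y - e := fun hh => hB hh.symm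
        have h2 : x ≠ y + f := fun hh => by
          have : x - f = y := by omega
          simp only [mem_movable, mem_slide] at *
          grind
        rw [if_neg h1, if_neg h2]

lemma deg_slide_unique (k : ℕ) {X : Finset ℕ} (hd : deg X = 1) {s t : ℕ}
    (hs : s ∈ movable (2 ^ k) X) (ht : t ∈ movable (2 ^ k) X)
    (hds : deg (slide (2 ^ k) s X) = 1) (hdt : deg (slide (2 ^ k) t X) = 1) : s = t := by
  induction hN : size X using Nat.strong_induction_on generalizing X s t with
  | _ N ih =>
  have hle := le_size_of_movable hs
  have hpos : 0 < 2 ^ k := by positivity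
  have hN0 : size X ≠ 0 := by omega
  have hKle : 2 ^ Nat.log 2 (size X) ≤ size X := Nat.pow_log_le_self 2 hN0
  have hKlt : size X < 2 * 2 ^ Nat.log 2 (size X) := by
    have := Nat.lt_pow_succ_log_self (b := 2) (by norm_num) (size X)
    rw [pow_succ] at this
    omega
  have hkK : k ≤ Nat.log 2 (size X) := Nat.le_log_of_pow_le (by norm_num) hle
  generalize Nat.log 2 (size X) = K at *
  rcases hkK.eq_or_lt with rfl | hlt
  · exact movable_unique hKlt hs ht
  have hfe : 2 ^ k < 2 ^ K := Nat.pow_lt_pow_right (by norm_num) hlt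
  obtain ⟨z, hz, hdz⟩ := exists_deg_eq_one hKle hd
  have hsz := size_slide hz
  by_cases hcase : 2 ^ k + 2 ^ K ≤ size X
  · have hs' := size_slide hs
    have ht' := size_slide ht
    obtain ⟨y, hy, hdy⟩ := exists_deg_eq_one (k := K) (by omega) hds
    obtain ⟨y', hy', hdy'⟩ := exists_deg_eq_one (k := K) (by omega) hdt
    obtain ⟨w, hw, hw1, hw2⟩ := slide_exchange hKlt hpos hfe hs hz hy
    obtain ⟨w', hw', hw1', hw2'⟩ := slide_exchange hKlt hpos hfe ht hz hy'
    have : w = w' := ih _ (by omega) hdz hw hw' (by rw [hw1, hdy]) (by rw [hw1', hdy']) rfl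
    rw [hw2, hw2', this]
  · by_contra hst
    have hcand : ∀ u ∈ movable (2 ^ k) X, u = z ∨ u = z - 2 ^ K + 2 ^ k := by
      intro u hu
      by_contra hne
      have : u ∈ movable (2 ^ k) (slide (2 ^ K) z X) := by
        simp only [mem_movable, mem_slide] at *
        grind
      have := le_size_of_movable this
      omega
    have hmov : movable (2 ^ k) X = {s, t} := by
      ext u
      simp only [Finset.mem_insert, Finset.mem_singleton]
      constructor
      · intro hu
        have h1 := hcand u hu
        have h2 := hcand s hs
        have h3 := hcand t ht
        omega
      · rintro (rfl | rfl) <;> assumption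
    rw [← lower_two_pow_deg k hle, lower, hmov, Finset.sum_pair hst, hds, hdt] at hd
    exact absurd hd (by decide)

/-- The even runner of the 2-abacus. -/
def evens (X : Finset ℕ) : Finset ℕ := (X.filter (fun b => b % 2 = 0)).image (fun b => b / 2)

/-- The odd runner of the 2-abacus. -/
def odds (X : Finset ℕ) : Finset ℕ := (X.filter (fun b => b % 2 = 1)).image (fun b => b / 2)

lemma mem_evens {X : Finset ℕ} {t : ℕ} : t ∈ evens X ↔ 2 * t ∈ X := by
  simp only [evens, Finset.mem_image, Finset.mem_filter]
  constructor
  · rintro ⟨b, ⟨hb, h⟩, rfl⟩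
    rwa [show 2 * (b / 2) = b by omega]
  · intro h
    exact ⟨2 * t, ⟨h, by omega⟩, by omega⟩

lemma mem_odds {X : Finset ℕ} {t : ℕ} : t ∈ odds X ↔ 2 * t + 1 ∈ X := by
  simp only [odds, Finset.mem_image, Finset.mem_filter]
  constructor
  · rintro ⟨b, ⟨hb, h⟩, rfl⟩
    rwa [show 2 * (b / 2) + 1 = b by omega]
  · intro h
    exact ⟨2 * t + 1, ⟨h, by omega⟩, by omega⟩

lemma eq_of_evens_odds {X Y : Finset ℕ} (h0 : evens X = evens Y) (h1 : odds X = odds Y) :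
    X = Y := by
  ext x
  obtain ⟨t, rfl | rfl⟩ : ∃ t, x = 2 * t ∨ x = 2 * t + 1 := ⟨x / 2, by omega⟩
  · rw [← mem_evens, h0, mem_evens]
  · rw [← mem_odds, h1, mem_odds]

lemma sum_evens_add_sum_odds {M : Type*} [AddCommMonoid M] (X : Finset ℕ) (F : ℕ → M) :
    ∑ x ∈ X, F x = ∑ t ∈ evens X, F (2 * t) + ∑ t ∈ odds X, F (2 * t + 1) := by
  rw [← Finset.sum_filter_add_sum_filter_not X (fun b => b % 2 = 0)]
  congr 1
  · refine Finset.sum_bij' (fun s _ => s / 2) (fun t _ => 2 * t) ?_ ?_ ?_ ?_ ?_ <;> intro s hs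
    · rw [Finset.mem_filter] at hs
      rw [mem_evens, show 2 * (s / 2) = s by omega]; exact hs.1
    · rw [mem_evens] at hs
      simp [hs]
    · rw [Finset.mem_filter] at hs; omega
    · omega
    · rw [Finset.mem_filter] at hs; rw [show 2 * (s / 2) = s by omega]
  · refine Finset.sum_bij' (fun s _ => s / 2) (fun t _ => 2 * t + 1) ?_ ?_ ?_ ?_ ?_ <;> intro s hs
    · rw [Finset.mem_filter] at hs
      rw [mem_odds, show 2 * (s / 2) + 1 = s by omega]; exact hs.1
    · rw [mem_odds] at hs
      simp only [Finset.mem_filter]; exact ⟨hs, by omega⟩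
    · rw [Finset.mem_filter] at hs; omega
    · omega
    · rw [Finset.mem_filter] at hs; rw [show 2 * (s / 2) + 1 = s by omega]

lemma evens_movable (e : ℕ) (X : Finset ℕ) : evens (movable (2 * e) X) = movable e (evens X) := by
  ext t
  rw [mem_evens, mem_movable, mem_movable, mem_evens, mem_evens, Nat.mul_sub,
    Nat.mul_le_mul_left_iff (by norm_num)]

lemma odds_movable (e : ℕ) (X : Finset ℕ) : odds (movable (2 * e) X) = movable e (odds X) := by
  ext t
  rw [mem_odds, mem_movable, mem_movable, mem_odds, mem_odds]
  refine and_congr Iff.rfl ⟨?_, ?_⟩ <;> rintro ⟨h1, h2⟩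
  · refine ⟨by omega, ?_⟩
    rwa [show 2 * (t - e) + 1 = 2 * t + 1 - 2 * e by omega]
  · refine ⟨by omega, ?_⟩
    rwa [show 2 * t + 1 - 2 * e = 2 * (t - e) + 1 by omega]

lemma evens_slide_even (e t : ℕ) (X : Finset ℕ) :
    evens (slide (2 * e) (2 * t) X) = slide e t (evens X) := by
  ext x
  simp only [mem_evens, mem_slide]
  have h1 : 2 * x = 2 * t - 2 * e ↔ x = t - e := by omega
  have h2 : 2 * x ≠ 2 * t ↔ x ≠ t := by omega
  rw [h1, h2]

lemma odds_slide_even (e t : ℕ) (X : Finset ℕ) :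
    odds (slide (2 * e) (2 * t) X) = odds X := by
  ext x
  simp only [mem_odds, mem_slide]
  have h1 : ¬ 2 * x + 1 = 2 * t - 2 * e := by omega
  have h2 : 2 * x + 1 ≠ 2 * t := by omega
  simp [h1, h2]

lemma evens_slide_odd {e t : ℕ} (h : e ≤ t) (X : Finset ℕ) :
    evens (slide (2 * e) (2 * t + 1) X) = evens X := by
  ext x
  simp only [mem_evens, mem_slide]
  have h1 : ¬ 2 * x = 2 * t + 1 - 2 * e := by omega
  have h2 : 2 * x ≠ 2 * t + 1 := by omega
  simp [h1, h2]

lemma odds_slide_odd {e t : ℕ} (h : e ≤ t) (X : Finset ℕ) :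
    odds (slide (2 * e) (2 * t + 1) X) = slide e t (odds X) := by
  ext x
  simp only [mem_odds, mem_slide]
  have h1 : 2 * x + 1 = 2 * t + 1 - 2 * e ↔ x = t - e := by omega
  have h2 : 2 * x + 1 ≠ 2 * t + 1 ↔ x ≠ t := by omega
  rw [h1, h2]

lemma lower_two_mul (e : ℕ) (g : Finset ℕ → ZMod 2) (X : Finset ℕ) :
    lower (2 * e) g X = ∑ t ∈ movable e (evens X), g (slide (2 * e) (2 * t) X) +
      ∑ t ∈ movable e (odds X), g (slide (2 * e) (2 * t + 1) X) := by
  rw [lower, sum_evens_add_sum_odds, evens_movable, odds_movable]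

lemma exists_mem_movable_one {X : Finset ℕ} (h : 0 < size X) : ∃ s, s ∈ movable 1 X := by
  rw [size_eq] at h
  obtain ⟨b, hb, h0⟩ := Finset.exists_ne_zero_of_sum_ne_zero h.ne'
  obtain ⟨s, hs, -⟩ := exists_movable_one hb (Nat.pos_of_ne_zero h0)
  exact ⟨s, hs⟩

lemma deg_of_size_lt_two {X : Finset ℕ} (h : size X < 2) : deg X = 1 := by
  rcases Nat.eq_zero_or_pos (size X) with h0 | h0
  · exact deg_of_size_zero h0
  · obtain ⟨s, hs⟩ := exists_mem_movable_one h0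
    have h1 : movable 1 X = {s} := by
      ext t
      rw [Finset.mem_singleton]
      constructor
      · intro ht; exact movable_unique (by omega) ht hs
      · rintro rfl; exact hs
    rw [← lower_one_deg h0, lower, h1, Finset.sum_singleton, deg_of_size_zero]
    have := size_slide hs
    omega

lemma size_evens_odds_of_size_lt_two {X : Finset ℕ} (h : size X < 2) :
    size (evens X) = 0 ∧ size (odds X) = 0 := by
  by_contra hne
  have : ∃ s, s ∈ movable (2 * 1) X := by
    by_cases h0 : size (evens X) = 0
    · obtain ⟨t, ht⟩ := exists_mem_movable_one (X := odds X) (by omega)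
      rw [← odds_movable, mem_odds] at ht
      exact ⟨_, ht⟩
    · obtain ⟨t, ht⟩ := exists_mem_movable_one (X := evens X) (by omega)
      rw [← evens_movable, mem_evens] at ht
      exact ⟨_, ht⟩
  obtain ⟨s, hs⟩ := this
  have := le_size_of_movable hs
  omega

lemma deg_eq_evens_odds (X : Finset ℕ) :
    deg X = if size X / 2 = size (evens X) + size (odds X) then
      ((size (evens X) + size (odds X)).choose (size (evens X)) : ZMod 2) *
        deg (evens X) * deg (odds X) else 0 := by
  induction hN : size X using Nat.strong_induction_on generalizing X with
  | _ N ih =>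
  subst hN
  by_cases hlt : size X < 2
  · obtain ⟨h0, h1⟩ := size_evens_odds_of_size_lt_two hlt
    rw [deg_of_size_lt_two hlt, h0, h1, deg_of_size_zero h0, deg_of_size_zero h1,
      if_pos (by omega)]
    simp
  · have hL : deg X = lower (2 * 1) deg X := by
      have := lower_two_pow_deg 1 (X := X) (by rw [pow_one]; omega)
      rw [pow_one] at this
      exact this.symm
    rw [hL, lower_two_mul]
    have hE : ∑ t ∈ movable 1 (evens X), deg (slide (2 * 1) (2 * t) X) =
        if size X / 2 = size (evens X) + size (odds X) then
          (if 0 < size (evens X) then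
            ((size (evens X) + size (odds X) - 1).choose (size (evens X) - 1) : ZMod 2) *
              deg (evens X) * deg (odds X) else 0) else 0 := by
      have h1 : ∀ t ∈ movable 1 (evens X), deg (slide (2 * 1) (2 * t) X) =
          (if size X / 2 = size (evens X) + size (odds X) then
            ((size (evens X) + size (odds X) - 1).choose (size (evens X) - 1) : ZMod 2)
            else 0) * deg (odds X) * deg (slide 1 t (evens X)) := by
        intro t ht
        have hs := size_slide ht
        rw [← evens_movable, mem_evens] at ht
        have hs' := size_slide ht
        rw [ih _ (by omega) _ rfl, evens_slide_even, odds_slide_even,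
          show size (slide 1 t (evens X)) = size (evens X) - 1 by omega]
        have h2 : (size (slide (2 * 1) (2 * t) X) / 2 = size (evens X) - 1 + size (odds X)) ↔
          (size X / 2 = size (evens X) + size (odds X)) := by omega
        rw [show size (evens X) - 1 + size (odds X) = size (evens X) + size (odds X) - 1 by omega]
          at h2 ⊢
        simp only [h2]
        split_ifs <;> ring
      rw [Finset.sum_congr rfl h1, ← Finset.mul_sum]
      rcases Nat.eq_zero_or_pos (size (evens X)) with h0 | h0
      · have : movable 1 (evens X) = ∅ := by
          refine Finset.eq_empty_of_forall_notMem (fun t ht => ?_)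
          have := le_size_of_movable ht
          omega
        rw [this, h0]; simp
      · rw [← lower, lower_one_deg h0, if_pos h0]
        split_ifs <;> ring
    have hO : ∑ t ∈ movable 1 (odds X), deg (slide (2 * 1) (2 * t + 1) X) =
        if size X / 2 = size (evens X) + size (odds X) then
          (if 0 < size (odds X) then
            ((size (evens X) + size (odds X) - 1).choose (size (evens X)) : ZMod 2) *
              deg (evens X) * deg (odds X) else 0) else 0 := by
      have h1 : ∀ t ∈ movable 1 (odds X), deg (slide (2 * 1) (2 * t + 1) X) =
          (if size X / 2 = size (evens X) + size (odds X) then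
            ((size (evens X) + size (odds X) - 1).choose (size (evens X)) : ZMod 2)
            else 0) * deg (evens X) * deg (slide 1 t (odds X)) := by
        intro t ht
        have hle := (mem_movable.1 ht).2.1
        have hs := size_slide ht
        rw [← odds_movable, mem_odds] at ht
        have hs' := size_slide ht
        rw [ih _ (by omega) _ rfl, evens_slide_odd hle, odds_slide_odd hle,
          show size (slide 1 t (odds X)) = size (odds X) - 1 by omega]
        have h2 : (size (slide (2 * 1) (2 * t + 1) X) / 2 = size (evens X) + (size (odds X) - 1)) ↔
          (size X / 2 = size (evens X) + size (odds X)) := by omega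
        rw [show size (evens X) + (size (odds X) - 1) = size (evens X) + size (odds X) - 1 by omega]
          at h2 ⊢
        simp only [h2]
        split_ifs <;> ring
      rw [Finset.sum_congr rfl h1, ← Finset.mul_sum]
      rcases Nat.eq_zero_or_pos (size (odds X)) with h0 | h0
      · have : movable 1 (odds X) = ∅ := by
          refine Finset.eq_empty_of_forall_notMem (fun t ht => ?_)
          have := le_size_of_movable ht
          omega
        rw [this, h0]; simp
      · rw [← lower, lower_one_deg h0, if_pos h0]
        split_ifs <;> ring
    rw [hE, hO]
    split_ifs with h1 h2 h3 h3
    · obtain ⟨a, ha⟩ : ∃ a, size (evens X) = a + 1 := ⟨size (evens X) - 1, by omega⟩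
      obtain ⟨b, hb⟩ : ∃ b, size (odds X) = b + 1 := ⟨size (odds X) - 1, by omega⟩
      rw [ha, hb, show a + 1 + (b + 1) - 1 = a + b + 1 by omega,
        show a + 1 + (b + 1) = a + b + 1 + 1 by omega, Nat.choose_succ_succ' (a + b + 1) a,
        Nat.cast_add]
      simp only [Nat.add_sub_cancel]
      ring
    · rw [show size (odds X) = 0 by omega]; simp
    · rw [show size (evens X) = 0 by omega]; simp
    · omega
    · simp

lemma deg_evens_odds {X : Finset ℕ} (h : deg X = 1) :
    size X / 2 = size (evens X) + size (odds X) ∧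
      Odd ((size (evens X) + size (odds X)).choose (size (evens X))) ∧
      deg (evens X) = 1 ∧ deg (odds X) = 1 := by
  rw [deg_eq_evens_odds] at h
  have key : ∀ a b c : ZMod 2, a * b * c = 1 → a = 1 ∧ b = 1 ∧ c = 1 := by decide
  split_ifs at h with h1
  · obtain ⟨h2, h3, h4⟩ := key _ _ _ h
    exact ⟨h1, ZMod.natCast_eq_one_iff_odd.1 h2, h3, h4⟩
  · exact absurd h (by decide)

lemma two_mul_choose_two_add (n : ℕ) : 2 * n.choose 2 + n = n * n := by
  induction n with
  | zero => rfl
  | succ n ih =>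
    rw [Nat.choose_succ_succ' n 1, Nat.choose_one_right]
    linarith

lemma card_evens_add_card_odds (X : Finset ℕ) : X.card = (evens X).card + (odds X).card := by
  have := sum_evens_add_sum_odds (M := ℕ) X (fun _ => 1)
  simpa only [← Finset.card_eq_sum_ones] using this

lemma sum_eq_evens_odds (X : Finset ℕ) :
    ∑ x ∈ X, x = 2 * ∑ t ∈ evens X, t + (2 * ∑ t ∈ odds X, t + (odds X).card) := by
  rw [sum_evens_add_sum_odds X (fun x => x), Finset.mul_sum, Finset.mul_sum,
    Finset.sum_add_distrib]
  simp

lemma eq_of_quotient {X Y : Finset ℕ} (hc : X.card = Y.card) (hs : size X = size Y)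
    (h0 : partOfBeta (evens X) = partOfBeta (evens Y))
    (h1 : partOfBeta (odds X) = partOfBeta (odds Y)) : X = Y := by
  have e0 : size (evens X) = size (evens Y) := congrArg Multiset.sum h0
  have e1 : size (odds X) = size (odds Y) := congrArg Multiset.sum h1
  have key : (evens X).card = (evens Y).card := by
    have f1 := size_add_choose X
    have f2 := size_add_choose Y
    have f3 := size_add_choose (evens X)
    have f4 := size_add_choose (evens Y)
    have f5 := size_add_choose (odds X)
    have f6 := size_add_choose (odds Y)
    rw [sum_eq_evens_odds, ← f3, ← f5] at f1
    rw [sum_eq_evens_odds, ← f4, ← f6, ← hs, ← hc, f1, e0, e1] at f2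
    have c1 := card_evens_add_card_odds X
    have c2 := card_evens_add_card_odds Y
    have t1 := two_mul_choose_two_add (evens X).card
    have t2 := two_mul_choose_two_add (evens Y).card
    have t3 := two_mul_choose_two_add (odds X).card
    have t4 := two_mul_choose_two_add (odds Y).card
    generalize (evens X).card = u at *
    generalize (evens Y).card = u' at *
    generalize (odds X).card = v at *
    generalize (odds Y).card = v' at *
    generalize u.choose 2 = p at *
    generalize u'.choose 2 = p' at *
    generalize v.choose 2 = q at *
    generalize v'.choose 2 = q' at *
    have hv : v' = u + v - u' := by omega
    have hq : 2 * p + 2 * q + v = 2 * p' + 2 * q' + v' := by omega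
    zify at *
    have hv' : (v' : ℤ) = u + v - u' := by omega
    have : ((u : ℤ) - u') * (2 * (u' - v) - 1) = 0 := by
      linear_combination hq - t1 - t3 + t2 + t4 + ((v' : ℤ) + u + v - u') * hv'
    rcases mul_eq_zero.1 this with h | h
    · omega
    · omega
  refine eq_of_evens_odds (partOfBeta_injective key h0) (partOfBeta_injective ?_ h1)
  have c1 := card_evens_add_card_odds X
  have c2 := card_evens_add_card_odds Y
  omega

lemma length_descList (lam : Multiset ℕ) : (descList lam).length = Multiset.card lam := by
  simp [descList]

lemma coe_descList (lam : Multiset ℕ) : (descList lam : Multiset ℕ) = lam := by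
  rw [descList, ← Multiset.coe_reverse, List.reverse_reverse, Multiset.sort_eq]

lemma getD_descList_anti (lam : Multiset ℕ) : Antitone (fun i => (descList lam).getD i 0) := by
  intro i j hij
  simp only
  have hp : (descList lam).Pairwise (· ≥ ·) := by
    rw [descList, List.pairwise_reverse]
    exact Multiset.pairwise_sort _ _
  by_cases hj : j < (descList lam).length
  · rw [List.getD_eq_getElem _ _ hj, List.getD_eq_getElem _ _ (lt_of_le_of_lt hij hj)]
    rcases Nat.lt_or_eq_of_le hij with h | h
    · exact List.pairwise_iff_getElem.1 hp i j _ _ h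
    · subst h; exact le_rfl
  · rw [List.getD_eq_default _ _ (not_lt.1 hj)]
    exact Nat.zero_le _

lemma map_getD_range (l : List ℕ) (m : ℕ) (h : l.length ≤ m) :
    (List.range m).map (fun i => l.getD i 0) = l ++ List.replicate (m - l.length) 0 := by
  refine List.ext_getElem (by simp [h]) (fun i h1 h2 => ?_)
  rw [List.getElem_map, List.getElem_range]
  by_cases hi : i < l.length
  · rw [List.getElem_append_left hi, List.getD_eq_getElem _ _ hi]
  · rw [List.getElem_append_right (not_lt.1 hi), List.getElem_replicate,
      List.getD_eq_default _ _ (not_lt.1 hi)]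

lemma bead_lt_bead (lam : Multiset ℕ) {m i j : ℕ} (h : i < j) (hj : j < m) :
    (descList lam).getD j 0 + (m - 1 - j) < (descList lam).getD i 0 + (m - 1 - i) := by
  have := getD_descList_anti lam h.le
  simp only at this
  omega

lemma bead_lt_bead_iff (lam : Multiset ℕ) {m i j : ℕ} (hi : i < m) (hj : j < m) :
    (descList lam).getD j 0 + (m - 1 - j) < (descList lam).getD i 0 + (m - 1 - i) ↔ i < j := by
  constructor
  · intro h
    by_contra hc
    rcases Nat.lt_or_eq_of_le (not_lt.1 hc) with h1 | h1
    · exact absurd (bead_lt_bead lam h1 hi) h.asymm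
    · subst h1; exact lt_irrefl _ h
  · intro h; exact bead_lt_bead lam h hj

lemma injOn_bead (lam : Multiset ℕ) (m : ℕ) :
    Set.InjOn (fun i => (descList lam).getD i 0 + (m - 1 - i)) (Finset.range m : Set ℕ) := by
  intro i hi j hj h
  simp only [Finset.coe_range, Set.mem_Iio] at hi hj h
  have h1 := (bead_lt_bead_iff lam hi hj).not.1 (by omega)
  have h2 := (bead_lt_bead_iff lam hj hi).not.1 (by omega)
  omega

lemma card_betaSet (lam : Multiset ℕ) (m : ℕ) : (betaSet lam m).card = m := by
  rw [betaSet, Finset.card_image_of_injOn (injOn_bead lam m), Finset.card_range]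

lemma gaps_betaSet (lam : Multiset ℕ) {m i : ℕ} (hi : i < m) :
    gaps (betaSet lam m) ((descList lam).getD i 0 + (m - 1 - i)) = (descList lam).getD i 0 := by
  have h : ((betaSet lam m).filter
      (fun a => a < (descList lam).getD i 0 + (m - 1 - i))).card = m - 1 - i := by
    rw [betaSet, Finset.filter_image, Finset.card_image_of_injOn
      ((injOn_bead lam m).mono (fun x hx => Finset.mem_coe.2 (Finset.mem_filter.1 hx).1))]
    have : (Finset.range m).filter (fun j => (descList lam).getD j 0 + (m - 1 - j) <
        (descList lam).getD i 0 + (m - 1 - i)) = Finset.Ioo i m := by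
      ext j
      rw [Finset.mem_filter, Finset.mem_range, Finset.mem_Ioo]
      constructor
      · rintro ⟨h1, h2⟩; exact ⟨(bead_lt_bead_iff lam hi h1).1 h2, h1⟩
      · rintro ⟨h1, h2⟩; exact ⟨h2, bead_lt_bead lam h1 h2⟩
    rw [this, Nat.card_Ioo]
    omega
  have := gaps_add (betaSet lam m) ((descList lam).getD i 0 + (m - 1 - i))
  omega

lemma partOfBeta_betaSet {lam : Multiset ℕ} (hpos : ∀ x ∈ lam, 0 < x) {m : ℕ}
    (hm : Multiset.card lam ≤ m) : partOfBeta (betaSet lam m) = lam := by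
  have h1 : (betaSet lam m).val.map (gaps (betaSet lam m)) =
      ((List.range m).map (fun i => (descList lam).getD i 0) : List ℕ) := by
    have h2 : (betaSet lam m).val = (Multiset.range m).map
        (fun i => (descList lam).getD i 0 + (m - 1 - i)) := by
      rw [betaSet, Finset.image_val_of_injOn (injOn_bead lam m), Finset.range_val]
    rw [h2, Multiset.map_map, ← Multiset.map_coe, ← Multiset.coe_range]
    refine Multiset.map_congr rfl (fun i hi => ?_)
    exact gaps_betaSet lam (Multiset.mem_range.1 hi)
  rw [partOfBeta_eq, h1, map_getD_range _ _ (by rwa [length_descList]), ← Multiset.coe_add,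
    coe_descList, Multiset.filter_add, Multiset.filter_eq_self.2 hpos, Multiset.coe_replicate,
    Multiset.filter_eq_nil.2, add_zero]
  intro a ha
  rw [Multiset.eq_of_mem_replicate ha]
  exact lt_irrefl 0

lemma betaSet_partOfBeta (X : Finset ℕ) : betaSet (partOfBeta X) X.card = X :=
  partOfBeta_injective (card_betaSet _ _)
    (partOfBeta_betaSet pos_of_mem_partOfBeta (card_partOfBeta_le X))

/-- Add one bead to a beta-set without changing the partition. -/
def shift (X : Finset ℕ) : Finset ℕ := insert 0 (X.image (fun x => x + 1))

lemma mem_shift {X : Finset ℕ} {x : ℕ} : x ∈ shift X ↔ x = 0 ∨ (x ≠ 0 ∧ x - 1 ∈ X) := by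
  simp only [shift, Finset.mem_insert, Finset.mem_image]
  refine or_congr Iff.rfl ⟨?_, ?_⟩
  · rintro ⟨y, hy, rfl⟩; exact ⟨by omega, hy⟩
  · rintro ⟨h, hx⟩; exact ⟨_, hx, by omega⟩

lemma betaSet_succ {lam : Multiset ℕ} {m : ℕ} (hm : Multiset.card lam ≤ m) :
    betaSet lam (m + 1) = shift (betaSet lam m) := by
  rw [betaSet, Finset.range_add_one, Finset.image_insert, shift,
    List.getD_eq_default _ _ (by rwa [length_descList]), betaSet, Finset.image_image]
  congr 1
  · omega
  · refine Finset.image_congr (fun i hi => ?_)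
    simp only [Finset.coe_range, Set.mem_Iio] at hi
    simp only [Function.comp]
    omega

lemma partOfBeta_shift (X : Finset ℕ) : partOfBeta (shift X) = partOfBeta X := by
  conv_lhs => rw [← betaSet_partOfBeta X, ← betaSet_succ (card_partOfBeta_le X)]
  exact partOfBeta_betaSet pos_of_mem_partOfBeta (by have := card_partOfBeta_le X; omega)

lemma evens_shift_shift (X : Finset ℕ) : evens (shift (shift X)) = shift (evens X) := by
  ext t
  simp only [mem_evens, mem_shift]
  rw [show 2 * t - 1 - 1 = 2 * (t - 1) by omega]
  constructor
  · rintro (h | ⟨h, h' | ⟨h', h''⟩⟩)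
    · left; omega
    · left; omega
    · right; exact ⟨by omega, h''⟩
  · rintro (h | ⟨h, h'⟩)
    · left; omega
    · right; exact ⟨by omega, Or.inr ⟨by omega, h'⟩⟩

lemma odds_shift_shift (X : Finset ℕ) : odds (shift (shift X)) = shift (odds X) := by
  ext t
  simp only [mem_odds, mem_shift]
  constructor
  · rintro (h | ⟨h, h' | ⟨h', h''⟩⟩)
    · left; omega
    · left; omega
    · right; refine ⟨by omega, ?_⟩
      rwa [show 2 * (t - 1) + 1 = 2 * t + 1 - 1 - 1 by omega]
  · rintro (h | ⟨h, h'⟩)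
    · right; exact ⟨by omega, Or.inl (by omega)⟩
    · right; refine ⟨by omega, Or.inr ⟨by omega, ?_⟩⟩
      rwa [show 2 * t + 1 - 1 - 1 = 2 * (t - 1) + 1 by omega]

lemma partOfBeta_evens_odds_betaSet {lam : Multiset ℕ} {m : ℕ} (hm : Multiset.card lam ≤ m)
    (j : ℕ) :
    partOfBeta (evens (betaSet lam (m + 2 * j))) = partOfBeta (evens (betaSet lam m)) ∧
      partOfBeta (odds (betaSet lam (m + 2 * j))) = partOfBeta (odds (betaSet lam m)) := by
  induction j with
  | zero => exact ⟨rfl, rfl⟩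
  | succ j ih =>
    rw [show m + 2 * (j + 1) = m + 2 * j + 1 + 1 by ring, betaSet_succ (by omega),
      betaSet_succ (by omega), evens_shift_shift, odds_shift_shift, partOfBeta_shift,
      partOfBeta_shift]
    exact ih

lemma quot2_partOfBeta {X : Finset ℕ} (h : Even X.card) :
    quot2 (partOfBeta X) = (partOfBeta (evens X), partOfBeta (odds X)) := by
  have hle := card_partOfBeta_le X
  obtain ⟨c, hc⟩ := h
  have h1 := partOfBeta_evens_odds_betaSet (lam := partOfBeta X)
    (m := 2 * Multiset.card (partOfBeta X)) (by omega) c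
  have h2 := partOfBeta_evens_odds_betaSet hle (Multiset.card (partOfBeta X))
  rw [betaSet_partOfBeta] at h2
  rw [show 2 * Multiset.card (partOfBeta X) + 2 * c =
    X.card + 2 * Multiset.card (partOfBeta X) by omega, h2.1, h2.2] at h1
  exact Prod.ext h1.1.symm h1.2.symm

/-- `mu` arises from the beta-set `X` by moving a bead down by `e` positions. -/
def SlidesTo (e : ℕ) (X : Finset ℕ) (mu : Multiset ℕ) : Prop :=
  ∃ s ∈ movable e X, mu = partOfBeta (slide e s X)

lemma slidesTo_shift {e : ℕ} (he : 0 < e) (X : Finset ℕ) (mu : Multiset ℕ) :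
    SlidesTo e (shift X) mu ↔ SlidesTo e X mu := by
  have key : ∀ s ∈ movable e X, s + 1 ∈ movable e (shift X) ∧
      partOfBeta (slide e (s + 1) (shift X)) = partOfBeta (slide e s X) := by
    intro s hs
    rw [mem_movable] at hs
    refine ⟨?_, ?_⟩
    · rw [mem_movable, mem_shift, mem_shift]
      refine ⟨Or.inr ⟨by omega, hs.1⟩, by omega, ?_⟩
      rintro (h | ⟨h, h'⟩)
      · omega
      · rw [show s + 1 - e - 1 = s - e by omega] at h'
        exact hs.2.2 h'
    · rw [← partOfBeta_shift (slide e s X)]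
      congr 1
      ext x
      simp only [mem_slide, mem_shift]
      have h1 : x = s + 1 - e ↔ x ≠ 0 ∧ x - 1 = s - e := by omega
      have h2 : x ≠ s + 1 ↔ x = 0 ∨ (x ≠ 0 ∧ x - 1 ≠ s) := by omega
      rw [h1, h2]
      tauto
  constructor
  · rintro ⟨s, hs, rfl⟩
    have hs' := mem_movable.1 hs
    rw [mem_shift, mem_shift] at hs'
    obtain ⟨h1, h2, h3⟩ := hs'
    obtain ⟨t, rfl⟩ : ∃ t, s = t + 1 := ⟨s - 1, by omega⟩
    have ht : t ∈ movable e X := by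
      rw [mem_movable]
      push Not at h3
      refine ⟨by simpa using h1, by omega, ?_⟩
      rw [show t - e = t + 1 - e - 1 by omega]
      exact h3.2 h3.1
    exact ⟨t, ht, (key t ht).2⟩
  · rintro ⟨s, hs, rfl⟩
    exact ⟨s + 1, (key s hs).1, (key s hs).2.symm⟩

lemma slidesTo_betaSet {e : ℕ} (he : 0 < e) {lam : Multiset ℕ} {m : ℕ}
    (hm : Multiset.card lam ≤ m) (mu : Multiset ℕ) (j : ℕ) :
    SlidesTo e (betaSet lam (m + j)) mu ↔ SlidesTo e (betaSet lam m) mu := by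
  induction j with
  | zero => rfl
  | succ j ih => rw [← add_assoc, betaSet_succ (by omega), slidesTo_shift he, ih]

lemma isHookRemoval_partOfBeta {e : ℕ} (he : 0 < e) (X : Finset ℕ) (mu : Multiset ℕ) :
    IsHookRemoval e (partOfBeta X) mu ↔ SlidesTo e X mu := by
  constructor
  · rintro ⟨h1, h2, -, m, x, h3, h4, h5, h6, h7, h8⟩
    have h9 : SlidesTo e (betaSet (partOfBeta X) m) mu := by
      refine ⟨x, mem_movable.2 ⟨h5, h6, h7⟩, ?_⟩
      rw [slide, ← h8, partOfBeta_betaSet h2 h4]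
    rw [← slidesTo_betaSet he h3 mu X.card, add_comm,
      slidesTo_betaSet he (card_partOfBeta_le X), betaSet_partOfBeta] at h9
    exact h9
  · rintro ⟨s, hs, rfl⟩
    have hc := card_slide hs
    have hs' := mem_movable.1 hs
    refine ⟨pos_of_mem_partOfBeta, pos_of_mem_partOfBeta, he, X.card, s, card_partOfBeta_le X,
      hc ▸ card_partOfBeta_le _, ?_⟩
    rw [betaSet_partOfBeta]
    refine ⟨hs'.1, hs'.2.1, hs'.2.2, ?_⟩
    rw [← hc, betaSet_partOfBeta]
    rfl

lemma exists_even_partOfBeta_eq {lam : Multiset ℕ} (h : ∀ x ∈ lam, 0 < x) :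
    ∃ X, Even X.card ∧ partOfBeta X = lam :=
  ⟨betaSet lam (2 * Multiset.card lam), by rw [card_betaSet]; exact even_two_mul _,
    partOfBeta_betaSet h (by omega)⟩

lemma oddP_partOfBeta {X : Finset ℕ} : OddP (partOfBeta X) ↔ deg X = 1 := by
  rw [OddP, deg, ZMod.natCast_eq_one_iff_odd]
  exact and_iff_right pos_of_mem_partOfBeta

lemma pos_quot2 (lam : Multiset ℕ) :
    (∀ x ∈ (quot2 lam).1, 0 < x) ∧ (∀ x ∈ (quot2 lam).2, 0 < x) :=
  ⟨pos_of_mem_partOfBeta (X := evens (betaSet lam (2 * Multiset.card lam))),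
    pos_of_mem_partOfBeta (X := odds (betaSet lam (2 * Multiset.card lam)))⟩

lemma IsHookRemoval.quot2 {e : ℕ} (he : 0 < e) {lam mu : Multiset ℕ}
    (h : IsHookRemoval (2 * e) lam mu) :
    (IsHookRemoval e (quot2 lam).1 (quot2 mu).1 ∧ (quot2 mu).2 = (quot2 lam).2) ∨
      ((quot2 mu).1 = (quot2 lam).1 ∧ IsHookRemoval e (quot2 lam).2 (quot2 mu).2) := by
  obtain ⟨X, hX, rfl⟩ := exists_even_partOfBeta_eq h.1
  obtain ⟨s, hs, rfl⟩ := (isHookRemoval_partOfBeta (by omega) X mu).1 h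
  rw [quot2_partOfBeta hX, quot2_partOfBeta (by rwa [card_slide hs])]
  obtain ⟨t, rfl | rfl⟩ : ∃ t, s = 2 * t ∨ s = 2 * t + 1 := ⟨s / 2, by omega⟩
  · rw [← mem_evens, evens_movable] at hs
    left
    rw [evens_slide_even, odds_slide_even]
    exact ⟨(isHookRemoval_partOfBeta he _ _).2 ⟨t, hs, rfl⟩, rfl⟩
  · rw [← mem_odds, odds_movable] at hs
    right
    have hle := (mem_movable.1 hs).2.1
    rw [evens_slide_odd hle, odds_slide_odd hle]
    exact ⟨rfl, (isHookRemoval_partOfBeta he _ _).2 ⟨t, hs, rfl⟩⟩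

lemma IsHookRemoval.sum_add {e : ℕ} {lam mu : Multiset ℕ} (h : IsHookRemoval e lam mu) :
    mu.sum + e = lam.sum := by
  obtain ⟨X, -, rfl⟩ := exists_even_partOfBeta_eq h.1
  obtain ⟨s, hs, rfl⟩ := (isHookRemoval_partOfBeta h.2.2.1 X mu).1 h
  exact size_slide hs

lemma IsHookRemoval.unique {k : ℕ} {lam mu mu' : Multiset ℕ} (hodd : OddP lam)
    (h : IsHookRemoval (2 ^ k) lam mu) (hmu : OddP mu)
    (h' : IsHookRemoval (2 ^ k) lam mu') (hmu' : OddP mu') : mu = mu' := by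
  obtain ⟨X, -, rfl⟩ := exists_even_partOfBeta_eq h.1
  obtain ⟨s, hs, rfl⟩ := (isHookRemoval_partOfBeta h.2.2.1 X mu).1 h
  obtain ⟨t, ht, rfl⟩ := (isHookRemoval_partOfBeta h.2.2.1 X mu').1 h'
  rw [oddP_partOfBeta] at hodd hmu hmu'
  rw [deg_slide_unique k hodd hs ht hmu hmu']

lemma exists_isHookRemoval {k : ℕ} {lam : Multiset ℕ} (hodd : OddP lam) (h : 2 ^ k ≤ lam.sum) :
    ∃ mu, IsHookRemoval (2 ^ k) lam mu ∧ OddP mu := by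
  obtain ⟨X, -, rfl⟩ := exists_even_partOfBeta_eq hodd.1
  rw [oddP_partOfBeta] at hodd
  obtain ⟨s, hs, hd⟩ := exists_deg_eq_one h hodd
  exact ⟨_, (isHookRemoval_partOfBeta (by positivity) X _).2 ⟨s, hs, rfl⟩, oddP_partOfBeta.2 hd⟩

lemma fkOp_spec {k : ℕ} {lam : Multiset ℕ} (hodd : OddP lam) (h : 2 ^ k ≤ lam.sum) :
    IsHookRemoval (2 ^ k) lam (fkOp k lam) ∧ OddP (fkOp k lam) := by
  rw [fkOp, dif_pos (exists_isHookRemoval hodd h)]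
  exact (exists_isHookRemoval hodd h).choose_spec

lemma fkOp_eq {k : ℕ} {lam mu : Multiset ℕ} (hodd : OddP lam)
    (h : IsHookRemoval (2 ^ k) lam mu) (hmu : OddP mu) : fkOp k lam = mu := by
  have hle : 2 ^ k ≤ lam.sum := by have := h.sum_add; omega
  exact (fkOp_spec hodd hle).1.unique hodd (fkOp_spec hodd hle).2 h hmu

lemma odd_choose_add {a b : ℕ} (h : Odd ((a + b).choose a)) :
    a % 2 + b % 2 = (a + b) % 2 ∧ Odd ((a / 2 + b / 2).choose (a / 2)) := by
  have : Fact (Nat.Prime 2) := ⟨Nat.prime_two⟩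
  have h1 := Choose.choose_modEq_choose_mod_mul_choose_div_nat (n := a + b) (k := a) (p := 2)
  rw [Nat.ModEq, Nat.odd_iff.1 h, eq_comm, ← Nat.odd_iff, Nat.odd_mul] at h1
  have h2 : a % 2 + b % 2 = (a + b) % 2 := by
    by_contra hne
    rw [show (a + b) % 2 = 0 by omega, show a % 2 = 1 by omega] at h1
    exact absurd h1.1 (by decide)
  refine ⟨h2, ?_⟩
  rw [show a / 2 + b / 2 = (a + b) / 2 by omega]
  exact h1.2

lemma testBit_add_of_odd_choose {a b : ℕ} (h : Odd ((a + b).choose a)) (i : ℕ) :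
    (a.testBit i).toNat + (b.testBit i).toNat = ((a + b).testBit i).toNat := by
  obtain ⟨h1, h2⟩ := odd_choose_add h
  induction i generalizing a b with
  | zero => simpa only [Nat.toNat_testBit, pow_zero, Nat.div_one] using h1
  | succ i ih =>
    simp only [Nat.testBit_succ]
    rw [show (a + b) / 2 = a / 2 + b / 2 by omega]
    exact ih h2 (odd_choose_add h2).1 (odd_choose_add h2).2

lemma OddP.quot2 {lam : Multiset ℕ} (hodd : OddP lam) :
    OddP (quot2 lam).1 ∧ OddP (quot2 lam).2 ∧
      ∀ i, ((quot2 lam).1.sum.testBit i).toNat + ((quot2 lam).2.sum.testBit i).toNat =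
        (lam.sum.testBit (i + 1)).toNat := by
  obtain ⟨X, hX, rfl⟩ := exists_even_partOfBeta_eq hodd.1
  rw [oddP_partOfBeta] at hodd
  obtain ⟨h1, h2, h3, h4⟩ := deg_evens_odds hodd
  rw [quot2_partOfBeta hX]
  refine ⟨oddP_partOfBeta.2 h3, oddP_partOfBeta.2 h4, fun i => ?_⟩
  rw [Nat.testBit_succ]
  change _ = ((size X / 2).testBit i).toNat
  rw [h1]
  exact testBit_add_of_odd_choose h2 i

lemma eq_of_quot2_eq {lam mu : Multiset ℕ} (hlam : ∀ x ∈ lam, 0 < x) (hmu : ∀ x ∈ mu, 0 < x)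
    (hs : lam.sum = mu.sum) (hq : quot2 lam = quot2 mu) : lam = mu := by
  have h1 := partOfBeta_betaSet hlam
    (show Multiset.card lam ≤ 2 * (Multiset.card lam + Multiset.card mu) by omega)
  have h2 := partOfBeta_betaSet hmu
    (show Multiset.card mu ≤ 2 * (Multiset.card lam + Multiset.card mu) by omega)
  have h3 := card_betaSet lam (2 * (Multiset.card lam + Multiset.card mu))
  have h4 := card_betaSet mu (2 * (Multiset.card lam + Multiset.card mu))
  generalize betaSet lam (2 * (Multiset.card lam + Multiset.card mu)) = X at h1 h3
  generalize betaSet mu (2 * (Multiset.card lam + Multiset.card mu)) = Y at h2 h4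
  rw [← h1, ← h2, quot2_partOfBeta (h3 ▸ even_two_mul _),
    quot2_partOfBeta (h4 ▸ even_two_mul _), Prod.mk.injEq] at hq
  rw [← h1, ← h2] at hs ⊢
  rw [eq_of_quotient (h3.trans h4.symm) hs hq.1 hq.2]

lemma towerRow_succ (k : ℕ) (lam : Multiset ℕ) :
    towerRow (k + 1) lam = towerRow k (quot2 lam).1 ++ towerRow k (quot2 lam).2 := by
  induction k with
  | zero => simp [towerRow]
  | succ k ih => rw [towerRow, ih, List.flatMap_append, ← towerRow, ← towerRow]

lemma length_towerRow (k : ℕ) (lam : Multiset ℕ) : (towerRow k lam).length = 2 ^ k := by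
  induction k generalizing lam with
  | zero => rfl
  | succ k ih => rw [towerRow_succ, List.length_append, ih, ih, pow_succ]; omega

lemma OddP.towerRow {lam : Multiset ℕ} (hodd : OddP lam) (k : ℕ) :
    (∀ ν ∈ towerRow k lam, OddP ν) ∧
      ∀ b, ((towerRow k lam).map (fun ν => (ν.sum.testBit b).toNat)).sum =
        (lam.sum.testBit (b + k)).toNat := by
  induction k generalizing lam with
  | zero => simpa [OddSym.towerRow] using hodd
  | succ k ih =>
    obtain ⟨h1, h2, h3⟩ := hodd.quot2
    rw [towerRow_succ]
    refine ⟨fun ν hν => ?_, fun b => ?_⟩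
    · rcases List.mem_append.1 hν with h | h
      · exact (ih h1).1 ν h
      · exact (ih h2).1 ν h
    · rw [List.map_append, List.sum_append, (ih h1).2, (ih h2).2, h3, add_assoc]

/-- The rows above row `k` of the 2-core towers of `lam` and `mu` have equal sizes. -/
def SameCores : ℕ → Multiset ℕ → Multiset ℕ → Prop
  | 0, _, _ => True
  | (k + 1), lam, mu =>
    lam.sum + 2 * ((quot2 mu).1.sum + (quot2 mu).2.sum) =
      mu.sum + 2 * ((quot2 lam).1.sum + (quot2 lam).2.sum) ∧
    SameCores k (quot2 lam).1 (quot2 mu).1 ∧ SameCores k (quot2 lam).2 (quot2 mu).2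

lemma SameCores.refl (k : ℕ) (lam : Multiset ℕ) : SameCores k lam lam := by
  induction k generalizing lam with
  | zero => trivial
  | succ k ih => exact ⟨rfl, ih _, ih _⟩

lemma SameCores.symm {k : ℕ} {lam mu : Multiset ℕ} (h : SameCores k lam mu) :
    SameCores k mu lam := by
  induction k generalizing lam mu with
  | zero => trivial
  | succ k ih => exact ⟨h.1.symm, ih h.2.1, ih h.2.2⟩

lemma SameCores.trans {k : ℕ} {lam mu nu : Multiset ℕ} (h : SameCores k lam mu)
    (h' : SameCores k mu nu) : SameCores k lam nu := by
  induction k generalizing lam mu nu with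
  | zero => trivial
  | succ k ih =>
    refine ⟨?_, ih h.2.1 h'.2.1, ih h.2.2 h'.2.2⟩
    have h1 := h.1
    have h2 := h'.1
    omega

lemma SameCores.eq_of_towerRow_eq {k : ℕ} {lam mu : Multiset ℕ} (h : SameCores k lam mu)
    (hlam : ∀ x ∈ lam, 0 < x) (hmu : ∀ x ∈ mu, 0 < x) (hr : towerRow k lam = towerRow k mu) :
    lam = mu := by
  induction k generalizing lam mu with
  | zero => simpa [towerRow] using hr
  | succ k ih =>
    rw [towerRow_succ, towerRow_succ] at hr
    obtain ⟨h1, h2⟩ := List.append_inj hr (by rw [length_towerRow, length_towerRow])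
    have h3 := ih h.2.1 (pos_quot2 _).1 (pos_quot2 _).1 h1
    have h4 := ih h.2.2 (pos_quot2 _).2 (pos_quot2 _).2 h2
    refine eq_of_quot2_eq hlam hmu ?_ (Prod.ext h3 h4)
    have := h.1
    rw [h3, h4] at this
    omega

lemma IsHookRemoval.towerRow {k e : ℕ} (he : 0 < e) {lam mu : Multiset ℕ}
    (h : IsHookRemoval (2 ^ k * e) lam mu) :
    SameCores k lam mu ∧ ∃ s < 2 ^ k, ∃ ν, IsHookRemoval e ((towerRow k lam).getD s 0) ν ∧
      towerRow k mu = (towerRow k lam).set s ν := by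
  induction k generalizing lam mu with
  | zero =>
    rw [pow_zero, one_mul] at h
    exact ⟨trivial, 0, by simp, mu, by simpa [OddSym.towerRow] using h, by simp [OddSym.towerRow]⟩
  | succ k ih =>
    have hE : 2 ^ (k + 1) * e = 2 * (2 ^ k * e) := by ring
    have hE0 : 0 < 2 ^ k * e := by positivity
    have hsum := h.sum_add
    rw [hE] at h hsum
    have hl1 := length_towerRow k (OddSym.quot2 lam).1
    rw [towerRow_succ, towerRow_succ]
    rcases h.quot2 hE0 with ⟨h1, h2⟩ | ⟨h2, h1⟩
    · have hs1 := h1.sum_add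
      obtain ⟨hc, s, hs, ν, hν, hr⟩ := ih h1
      refine ⟨⟨by rw [h2]; omega, hc, h2 ▸ SameCores.refl _ _⟩, s, by rw [pow_succ]; omega, ν, ?_, ?_⟩
      · rwa [List.getD_append _ _ _ _ (by omega)]
      · rw [hr, h2, List.set_append_left _ _ (by omega)]
    · have hs1 := h1.sum_add
      obtain ⟨hc, s, hs, ν, hν, hr⟩ := ih h1
      refine ⟨⟨by rw [h2]; omega, h2 ▸ SameCores.refl _ _, hc⟩, 2 ^ k + s, by rw [pow_succ]; omega,
        ν, ?_, ?_⟩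
      · rw [List.getD_append_right _ _ _ _ (by omega), hl1, Nat.add_sub_cancel_left]
        exact hν
      · rw [hr, h2, List.set_append_right _ _ (by omega), hl1, Nat.add_sub_cancel_left]

lemma sum_map_eq_sum_range {α : Type*} (l : List α) (d : α) (g : α → ℕ) :
    (l.map g).sum = ∑ i ∈ Finset.range l.length, g (l.getD i d) := by
  induction l with
  | nil => simp
  | cons x l ih =>
    rw [List.map_cons, List.sum_cons, List.length_cons, Finset.sum_range_succ', ih, add_comm]
    simp

lemma OddP.sum_testBit {lam : Multiset ℕ} (hodd : OddP lam) (k b : ℕ) :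
    ∑ s ∈ Finset.range (2 ^ k), (((OddSym.towerRow k lam).getD s 0).sum.testBit b).toNat =
      (lam.sum.testBit (b + k)).toNat := by
  rw [← (hodd.towerRow k).2 b,
    sum_map_eq_sum_range _ 0 (fun ν : Multiset ℕ => (ν.sum.testBit b).toNat), length_towerRow]

lemma OddP.getD_towerRow {lam : Multiset ℕ} (hodd : OddP lam) {k s : ℕ} (hs : s < 2 ^ k) :
    OddP ((OddSym.towerRow k lam).getD s 0) := by
  have h : s < (OddSym.towerRow k lam).length := by rwa [length_towerRow]
  rw [List.getD_eq_getElem _ _ h]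
  exact (hodd.towerRow k).1 _ (List.getElem_mem h)

lemma OddP.testBit_sum {lam : Multiset ℕ} (hodd : OddP lam) {k s b : ℕ} (hs : s < 2 ^ k)
    (h : ((OddSym.towerRow k lam).getD s 0).sum.testBit b = true) :
    lam.sum.testBit (b + k) = true := by
  have h1 := Finset.single_le_sum
    (f := fun s => (((OddSym.towerRow k lam).getD s 0).sum.testBit b).toNat)
    (fun i _ => Nat.zero_le _) (Finset.mem_range.2 hs)
  rw [hodd.sum_testBit, h] at h1
  by_contra hc
  rw [Bool.not_eq_true] at hc
  rw [hc] at h1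
  exact absurd h1 (by decide)

lemma OddP.exists_testBit {lam : Multiset ℕ} (hodd : OddP lam) {k b : ℕ}
    (h : lam.sum.testBit (b + k) = true) :
    ∃ s < 2 ^ k, ((OddSym.towerRow k lam).getD s 0).sum.testBit b = true := by
  have h1 := hodd.sum_testBit k b
  rw [h] at h1
  obtain ⟨s, hs, h2⟩ := Finset.exists_ne_zero_of_sum_ne_zero (h1.trans_ne (by decide))
  refine ⟨s, Finset.mem_range.1 hs, ?_⟩
  by_contra hc
  rw [Bool.not_eq_true] at hc
  rw [hc] at h2
  exact h2 rfl

lemma OddP.testBit_unique {lam : Multiset ℕ} (hodd : OddP lam) {k b s t : ℕ} (hs : s < 2 ^ k)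
    (ht : t < 2 ^ k) (h : ((OddSym.towerRow k lam).getD s 0).sum.testBit b = true)
    (h' : ((OddSym.towerRow k lam).getD t 0).sum.testBit b = true) : s = t := by
  by_contra hne
  have h1 : ∑ i ∈ {s, t}, (((OddSym.towerRow k lam).getD i 0).sum.testBit b).toNat ≤
      ∑ i ∈ Finset.range (2 ^ k), (((OddSym.towerRow k lam).getD i 0).sum.testBit b).toNat :=
    Finset.sum_le_sum_of_subset (by
      intro i hi
      rw [Finset.mem_insert, Finset.mem_singleton] at hi
      rw [Finset.mem_range]
      rcases hi with rfl | rfl <;> assumption)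
  rw [Finset.sum_pair hne, h, h', hodd.sum_testBit] at h1
  have := Bool.toNat_le (lam.sum.testBit (b + k))
  simp only [Bool.toNat_true] at h1
  omega

lemma testBit_sub_two_pow {N j T : ℕ} (hj : j ≤ T) (hT : N.testBit T = true)
    (h : ∀ i, j ≤ i → i < T → N.testBit i = false) : (N - 2 ^ j).testBit T = false := by
  obtain ⟨c, rfl⟩ := Nat.exists_eq_add_of_le hj
  rw [Nat.testBit_eq_decide_div_mod_eq, decide_eq_true_eq] at hT
  rw [Nat.testBit_eq_decide_div_mod_eq, decide_eq_false_iff_not]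
  rw [pow_add, ← Nat.div_div_eq_div_mul] at hT ⊢
  have h1 : (N - 2 ^ j) / 2 ^ j = N / 2 ^ j - 1 := by
    simpa using Nat.sub_mul_div N (2 ^ j) 1
  have h2 : N / 2 ^ j % 2 ^ c = 0 := by
    refine Nat.eq_of_testBit_eq (fun i => ?_)
    rw [Nat.testBit_mod_two_pow, Nat.testBit_div_two_pow, Nat.zero_testBit]
    by_cases hi : i < c
    · rw [h _ (by omega) (by omega), Bool.and_false]
    · simp [hi]
  rw [h1]
  obtain ⟨d, hd⟩ := Nat.dvd_of_mod_eq_zero h2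
  rw [hd, Nat.mul_div_cancel_left _ (by positivity)] at hT
  obtain ⟨f, rfl⟩ : ∃ f, d = f + 1 := ⟨d - 1, by omega⟩
  have h3 : (2 ^ c * (f + 1) - 1) / 2 ^ c = f := by
    have h4 : 0 < 2 ^ c := by positivity
    have h5 : (f + 1) * 2 ^ c = f * 2 ^ c + 2 ^ c := by ring
    rw [mul_comm]
    refine Nat.div_eq_of_lt_le ?_ ?_ <;> rw [h5] <;> omega
  rw [hd, h3]
  omega

lemma getD_set_self {l : List (Multiset ℕ)} {s : ℕ} (hs : s < l.length) (ν : Multiset ℕ) :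
    (l.set s ν).getD s 0 = ν := by
  rw [List.getD_eq_getElem _ _ (by rwa [List.length_set]), List.getElem_set_self]

lemma getD_set_of_ne {l : List (Multiset ℕ)} {s t : ℕ} (h : s ≠ t) (ν : Multiset ℕ) :
    (l.set s ν).getD t 0 = l.getD t 0 := by
  rw [List.getD_eq_getElem?_getD, List.getElem?_set_ne h, List.getD_eq_getElem?_getD]

lemma towerRow_fkOp {lam : Multiset ℕ} (hodd : OddP lam) {k e s t : ℕ}
    (hle : 2 ^ (k + e) ≤ lam.sum) (hs : s < 2 ^ k) (het : e ≤ t)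
    (ht : ((towerRow k lam).getD s 0).sum.testBit t = true)
    (hlow : ∀ i, e ≤ i → i < t → lam.sum.testBit (i + k) = false) :
    towerRow k (fkOp (k + e) lam) =
        (towerRow k lam).set s (fkOp e ((towerRow k lam).getD s 0)) ∧
      SameCores k lam (fkOp (k + e) lam) := by
  obtain ⟨h1, h2⟩ := fkOp_spec hodd hle
  have hsum := h1.sum_add
  rw [pow_add] at h1
  obtain ⟨hc, u, hu, ν, hν, hr⟩ := h1.towerRow (by positivity)
  refine ⟨?_, hc⟩
  have hus : u = s := by
    by_contra hne
    have h3 : (towerRow k (fkOp (k + e) lam)).getD s 0 = (towerRow k lam).getD s 0 := by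
      rw [hr, getD_set_of_ne hne]
    have h4 := h2.testBit_sum hs (h3 ▸ ht)
    rw [show (fkOp (k + e) lam).sum = lam.sum - 2 ^ (k + e) by omega,
      testBit_sub_two_pow (by omega) (hodd.testBit_sum hs ht)] at h4
    · exact absurd h4 (by decide)
    · intro i h5 h6
      rw [← hlow (i - k) (by omega) (by omega), Nat.sub_add_cancel (by omega)]
  subst hus
  have h3 : (towerRow k (fkOp (k + e) lam)).getD u 0 = ν := by
    rw [hr, getD_set_self (by rwa [length_towerRow])]
  rw [hr, fkOp_eq (hodd.getD_towerRow hs) hν (h3 ▸ h2.getD_towerRow hs)]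

lemma testBit_sum_two_pow_iff {S : Finset ℕ} {a : ℕ → ℕ} (ha : Set.InjOn a S) (j : ℕ) :
    (∑ i ∈ S, 2 ^ a i).testBit j = true ↔ ∃ i ∈ S, a i = j := by
  rw [← Nat.mem_bitIndices, ← List.mem_toFinset, ← Finset.sum_image (f := fun x => 2 ^ x) ha,
    Finset.toFinset_bitIndices_sum_two_pow, Finset.mem_image]

lemma testBit_iff_of_gt {n r : ℕ} {a : ℕ → ℕ}
    (hdec : ∀ i j, 1 ≤ i → i < j → j ≤ r → a j < a i)
    (hn : n = ∑ i ∈ Finset.Icc 1 r, 2 ^ a i) (j : ℕ) :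
    n.testBit j = true ↔ ∃ i ∈ Finset.Icc 1 r, a i = j := by
  rw [hn]
  refine testBit_sum_two_pow_iff (fun x hx y hy hxy => ?_) j
  rw [Finset.coe_Icc, Set.mem_Icc] at hx hy
  by_contra hne
  rcases Nat.lt_or_gt_of_ne hne with h | h
  · have := hdec x y hx.1 h hy.2; omega
  · have := hdec y x hy.1 h hx.2; omega

lemma testBit_eq_false_of_le_of_lt {n r c p : ℕ} {a : ℕ → ℕ}
    (hdec : ∀ i j, 1 ≤ i → i < j → j ≤ r → a j < a i)
    (hn : n = ∑ i ∈ Finset.Icc 1 r, 2 ^ a i) (hp : p ∈ Finset.Icc 1 r)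
    (hpmax : ∀ i ∈ Finset.Icc 1 r, c ≤ a i → i ≤ p) {j : ℕ} (hc : c ≤ j) (hj : j < a p) :
    n.testBit j = false := by
  rw [← Bool.not_eq_true, testBit_iff_of_gt hdec hn]
  rintro ⟨i, hi, rfl⟩
  have h1 := hpmax i hi hc
  rw [Finset.mem_Icc] at hi hp
  rcases Nat.lt_or_eq_of_le h1 with h2 | rfl
  · have := hdec i p hi.1 h2 hp.2; omega
  · omega

lemma sum_getD_towerRow_le {k e : ℕ} (he : 0 < e) {lam mu : Multiset ℕ}
    (h : IsHookRemoval (2 ^ k * e) lam mu) (t : ℕ) :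
    ((towerRow k mu).getD t 0).sum ≤ ((towerRow k lam).getD t 0).sum := by
  obtain ⟨-, s, hs, ν, hν, hr⟩ := h.towerRow he
  rw [hr]
  by_cases hst : s = t
  · subst hst
    rw [getD_set_self (by rwa [length_towerRow])]
    have := hν.sum_add
    omega
  · rw [getD_set_of_ne hst]

/-- If the lowest relevant digits of the size of `lam` belong to the same component of row `k`,
then `f_k (f_k lam) = f_(k+1) lam` can be tested on that component. -/
lemma fkOp_fkOp_eq_iff_of_same {k s P Q : ℕ} {lam : Multiset ℕ} (hodd : OddP lam)
    (hle : 2 ^ (k + 1) ≤ lam.sum) (hs : s < 2 ^ k) (hP : 1 ≤ P) (hQ : Q = 0 ∨ Q = P)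
    (hbP : ((towerRow k lam).getD s 0).sum.testBit P = true)
    (hbQ : ((towerRow k lam).getD s 0).sum.testBit Q = true)
    (hlowP : ∀ i, 1 ≤ i → i < P → lam.sum.testBit (i + k) = false)
    (hlowQ : ∀ i, i < Q → lam.sum.testBit (i + k) = false) :
    fkOp k (fkOp k lam) = fkOp (k + 1) lam ↔
      fkOp 0 (fkOp 0 ((towerRow k lam).getD s 0)) = fkOp 1 ((towerRow k lam).getD s 0) := by
  have hpow : 2 ^ (k + 1) = 2 ^ k + 2 ^ k := by rw [pow_succ]; omega
  have hlen := length_towerRow k lam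
  obtain ⟨g1, g2⟩ := fkOp_spec (k := k) hodd (by omega)
  obtain ⟨g3, g4⟩ := fkOp_spec hodd hle
  have gs1 := g1.sum_add
  obtain ⟨g5, g6⟩ := fkOp_spec (k := k) g2 (by omega)
  obtain ⟨r1, c1⟩ := towerRow_fkOp (e := 0) hodd (by rw [add_zero]; omega) hs (Nat.zero_le Q) hbQ
    (fun i _ hi => hlowQ i hi)
  obtain ⟨r2, c2⟩ := towerRow_fkOp (e := 1) hodd hle hs hP hbP hlowP
  rw [add_zero] at r1 c1
  have hν := hodd.getD_towerRow hs
  set ν := (towerRow k lam).getD s 0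
  have hν0 : 2 ^ 0 ≤ ν.sum := by
    rw [pow_zero, Nat.one_le_iff_ne_zero]
    intro h0
    rw [h0, Nat.zero_testBit] at hbP
    exact absurd hbP (by decide)
  have hν1 := (fkOp_spec hν hν0).1.sum_add
  rw [pow_zero] at hν1
  have hcomp : (towerRow k (fkOp k lam)).getD s 0 = fkOp 0 ν := by
    rw [r1, getD_set_self (by omega)]
  obtain ⟨t, ht1, ht2⟩ : ∃ t, (fkOp 0 ν).sum.testBit t = true ∧
      ∀ i, i < t → (fkOp k lam).sum.testBit (i + k) = false := by
    rcases hQ with rfl | rfl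
    · refine ⟨P, ?_, fun i hi => ?_⟩
      · obtain ⟨d, rfl⟩ : ∃ d, P = d + 1 := ⟨P - 1, by omega⟩
        rw [Nat.testBit_zero, decide_eq_true_eq] at hbQ
        rw [Nat.testBit_succ] at hbP ⊢
        rwa [show (fkOp 0 ν).sum / 2 = ν.sum / 2 by omega]
      · have hn1 := hodd.testBit_sum hs hbQ
        rw [zero_add, Nat.testBit_eq_decide_div_mod_eq, decide_eq_true_eq] at hn1
        have h1 : (fkOp k lam).sum / 2 ^ k = lam.sum / 2 ^ k - 1 := by
          rw [show (fkOp k lam).sum = lam.sum - 2 ^ k by omega]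
          simpa using Nat.sub_mul_div lam.sum (2 ^ k) 1
        rw [← Nat.testBit_div_two_pow, h1]
        rcases Nat.eq_zero_or_pos i with rfl | hi0
        · rw [Nat.testBit_zero, decide_eq_false_iff_not]
          omega
        · have h2 := hlowP i hi0 hi
          obtain ⟨d, rfl⟩ : ∃ d, i = d + 1 := ⟨i - 1, by omega⟩
          rw [← Nat.testBit_div_two_pow, Nat.testBit_succ] at h2
          have h3 : ∀ x, x % 2 = 1 → (x - 1) / 2 = x / 2 := fun x hx => by omega
          rwa [Nat.testBit_succ, h3 _ hn1]
    · refine ⟨0, ?_, fun i hi => absurd hi (Nat.not_lt_zero i)⟩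
      have h0 : ν.sum.testBit 0 = false := by
        rw [← Bool.not_eq_true]
        intro h
        have := hodd.testBit_sum hs h
        rw [hlowQ 0 (by omega)] at this
        exact absurd this (by decide)
      rw [Nat.testBit_zero, decide_eq_false_iff_not] at h0
      rw [Nat.testBit_zero, decide_eq_true_eq]
      omega
  obtain ⟨r3, c3⟩ := towerRow_fkOp (e := 0) g2 (by rw [add_zero]; omega) hs (Nat.zero_le t)
    (by rwa [hcomp]) (fun i _ hi => ht2 i hi)
  rw [add_zero, hcomp, r1, List.set_set] at r3
  rw [add_zero] at c3
  constructor
  · intro h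
    rw [h, r2] at r3
    have h1 := congrArg (fun l => l.getD s 0) r3
    rw [getD_set_self (by omega), getD_set_self (by omega)] at h1
    exact h1.symm
  · intro h
    refine ((c1.trans c3).symm.trans c2).eq_of_towerRow_eq g6.1 g4.1 ?_
    rw [r3, r2, h]

lemma fkOp_fkOp_ne_of_ne {k s u P Q : ℕ} {lam : Multiset ℕ} (hodd : OddP lam)
    (hle : 2 ^ (k + 1) ≤ lam.sum) (hs : s < 2 ^ k) (hu : u < 2 ^ k) (hsu : s ≠ u) (hP : 1 ≤ P)
    (hbP : ((towerRow k lam).getD s 0).sum.testBit P = true)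
    (hbQ : ((towerRow k lam).getD u 0).sum.testBit Q = true)
    (hlowP : ∀ i, 1 ≤ i → i < P → lam.sum.testBit (i + k) = false)
    (hlowQ : ∀ i, i < Q → lam.sum.testBit (i + k) = false) :
    fkOp k (fkOp k lam) ≠ fkOp (k + 1) lam := by
  intro heq
  have hpow : 2 ^ (k + 1) = 2 ^ k + 2 ^ k := by rw [pow_succ]; omega
  have hlen := length_towerRow k lam
  obtain ⟨g1, g2⟩ := fkOp_spec (k := k) hodd (by omega)
  have gs1 := g1.sum_add
  obtain ⟨g5, g6⟩ := fkOp_spec (k := k) g2 (by omega)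
  obtain ⟨r1, -⟩ := towerRow_fkOp (e := 0) hodd (by rw [add_zero]; omega) hu (Nat.zero_le Q) hbQ
    (fun i _ hi => hlowQ i hi)
  obtain ⟨r2, -⟩ := towerRow_fkOp (e := 1) hodd hle hs hP hbP hlowP
  rw [add_zero] at r1
  have h1 := sum_getD_towerRow_le (k := k) (e := 1) one_pos (by rwa [mul_one]) u (lam := fkOp k lam)
    (mu := fkOp k (fkOp k lam))
  rw [heq, r1, r2, getD_set_of_ne hsu, getD_set_self (by omega)] at h1
  have hν0 : 2 ^ 0 ≤ ((towerRow k lam).getD u 0).sum := by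
    rw [pow_zero, Nat.one_le_iff_ne_zero]
    intro h0
    rw [h0, Nat.zero_testBit] at hbQ
    exact absurd hbQ (by decide)
  have := (fkOp_spec (hodd.getD_towerRow hu) hν0).1.sum_add
  rw [pow_zero] at this
  omega

theorem stmt6 (k n r : ℕ) (hkn : 2 ^ (k + 1) ≤ n) (a : ℕ → ℕ)
    (hdec : ∀ i j, 1 ≤ i → i < j → j ≤ r → a j < a i)
    (hn : n = ∑ i ∈ Finset.Icc 1 r, 2 ^ a i)
    (p q : ℕ) (hp : p ∈ Finset.Icc 1 r) (hap : k + 1 ≤ a p)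
    (hpmax : ∀ i ∈ Finset.Icc 1 r, k + 1 ≤ a i → i ≤ p)
    (hq : q ∈ Finset.Icc 1 r) (haq : k ≤ a q)
    (hqmax : ∀ i ∈ Finset.Icc 1 r, k ≤ a i → i ≤ q)
    (τ : List ℕ) (lam : Multiset ℕ) (hodd : OddP lam) (hsum : lam.sum = n)
    (htype : (towerRow k lam).map Multiset.sum = τ) :
    fkOp k (fkOp k lam) = fkOp (k + 1) lam ↔
      ∃ s, s < 2 ^ k ∧ Nat.testBit (τ.getD s 0) (a p - k) ∧
        Nat.testBit (τ.getD s 0) (a q - k) ∧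
        OddP ((towerRow k lam).getD s 0) ∧
        fkOp 0 (fkOp 0 ((towerRow k lam).getD s 0)) =
          fkOp 1 ((towerRow k lam).getD s 0) := by
  have hbits := testBit_iff_of_gt hdec hn
  have hnp : n.testBit (a p) = true := (hbits _).2 ⟨p, hp, rfl⟩
  have hnq : n.testBit (a q) = true := (hbits _).2 ⟨q, hq, rfl⟩
  have hlowp : ∀ j, k + 1 ≤ j → j < a p → n.testBit j = false :=
    fun j h1 h2 => testBit_eq_false_of_le_of_lt hdec hn hp hpmax h1 h2
  have hlowq : ∀ j, k ≤ j → j < a q → n.testBit j = false :=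
    fun j h1 h2 => testBit_eq_false_of_le_of_lt hdec hn hq hqmax h1 h2
  clear hbits hpmax hqmax hdec hp hq hn
  obtain ⟨P, hP⟩ := Nat.exists_eq_add_of_le' (show k ≤ a p by omega)
  obtain ⟨Q, hQ⟩ := Nat.exists_eq_add_of_le' haq
  rw [hP] at hnp hlowp hap
  rw [hQ] at hnq hlowq
  rw [hP, hQ, Nat.add_sub_cancel, Nat.add_sub_cancel]
  subst hsum htype
  have hlowP : ∀ i, 1 ≤ i → i < P → lam.sum.testBit (i + k) = false :=
    fun i h1 h2 => hlowp _ (by omega) (by omega)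
  have hlowQ : ∀ i, i < Q → lam.sum.testBit (i + k) = false :=
    fun i h1 => hlowq _ (by omega) (by omega)
  have hP1 : 1 ≤ P := by omega
  have hPQ : Q = 0 ∨ Q = P := by
    rcases Nat.eq_zero_or_pos Q with h0 | h0
    · exact Or.inl h0
    · right
      rcases Nat.lt_trichotomy Q P with h | h | h
      · rw [hlowP Q h0 h] at hnq; exact absurd hnq (by decide)
      · exact h
      · rw [hlowQ P h] at hnp; exact absurd hnp (by decide)
  have hτ : ∀ s, ((towerRow k lam).map Multiset.sum).getD s 0 =
      ((towerRow k lam).getD s 0).sum := by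
    intro s
    have := List.getD_map (l := towerRow k lam) (d := (0 : Multiset ℕ)) (n := s) Multiset.sum
    rwa [Multiset.sum_zero] at this
  simp only [hτ]
  obtain ⟨s, hs, hbs⟩ := hodd.exists_testBit hnp
  obtain ⟨u, hu, hbu⟩ := hodd.exists_testBit hnq
  by_cases hsu : s = u
  · subst hsu
    rw [fkOp_fkOp_eq_iff_of_same hodd hkn hs hP1 hPQ hbs hbu hlowP hlowQ]
    constructor
    · intro h
      exact ⟨s, hs, hbs, hbu, hodd.getD_towerRow hs, h⟩
    · rintro ⟨v, hv, hbv, -, -, h⟩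
      rwa [hodd.testBit_unique hs hv hbs hbv]
  · refine iff_of_false (fkOp_fkOp_ne_of_ne hodd hkn hs hu hsu hP1 hbs hbu hlowP hlowQ) ?_
    rintro ⟨v, hv, hbv, hbv', -, -⟩
    exact hsu ((hodd.testBit_unique hs hv hbs hbv).trans (hodd.testBit_unique hv hu hbv' hbu))

end OddSym
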